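/- arXiv:0906.5313 — 3 statements merged into one kernel-verified Lean document; each statement's English description precedes it below -/
import Mathlib

section
/- Let D ≥ 4 be an even integer, set k = (D−2)/2, let δ ∈ ℂ \ ℤ and δ_D = δ + k, let β ∈ (0,π), z = cos β, and let h ∈ ℂ with |h| < 1. Define G(z) = (1/(2δ_D)) · ( e^{iδ_D β} ₂F₁(δ_D, 1; 1+δ_D; h e^{iβ}) + e^{−iδ_D β} ₂F₁(δ_D, 1; 1+δ_D; h e^{−iβ}) ), regarded as a function of z ∈ (−1,1) via β = arccos z, with h held fixed. Then the series Σ_{l=0}^∞ h^l P(z, l+δ, D) converges and Σ_{l=0}^∞ h^l P(z, l+δ, D) = (1/(2^k · k!)) · (d/dz)^k G(z). (Shifted generating-function formula in even dimensions.) -/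
open Filter

/-- Pochhammer symbol `(a)ₙ = a(a+1)⋯(a+n-1)` for complex `a`. -/
noncomputable def poch (a : ℂ) (n : ℕ) : ℂ := ∏ k ∈ Finset.range n, (a + k)

/-- Gauss hypergeometric series `₂F₁(a,b;c;x)`. -/
noncomputable def F21 (a b c x : ℂ) : ℂ :=
  ∑' n : ℕ, poch a n * poch b n / (poch c n * n.factorial) * x ^ n

/-- `D`-dimensional Legendre (Gegenbauer) function `P(z, ν, D)`. -/
noncomputable def legP (z ν : ℂ) (D : ℕ) : ℂ :=
  Complex.Gamma (ν + D - 2) / (Complex.Gamma (ν + 1) * Complex.Gamma ((D : ℂ) - 1)) *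
    F21 (-ν) (ν + (D : ℂ) - 2) (((D : ℂ) - 1) / 2) ((1 - z) / 2)

lemma poch_succ (a : ℂ) (n : ℕ) : poch a (n + 1) = poch a n * (a + n) := by
  simp [poch, Finset.prod_range_succ]

lemma poch_ne_zero {a : ℂ} (ha : ∀ n : ℕ, a + n ≠ 0) (n : ℕ) : poch a n ≠ 0 :=
  Finset.prod_ne_zero_iff.mpr fun i _ => ha i

lemma poch_succ' (a : ℂ) (n : ℕ) : poch a (n + 1) = a * poch (a + 1) n := by
  rw [poch, Finset.prod_range_succ', poch]
  push_cast
  rw [mul_comm]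
  simp [add_comm, add_left_comm]

/-- The `n`-th coefficient of the Gauss hypergeometric series. -/
noncomputable def gaussCoeff (a b c : ℂ) (n : ℕ) : ℂ :=
  poch a n * poch b n / (poch c n * n.factorial)

lemma F21_eq_tsum (a b c x : ℂ) : F21 a b c x = ∑' n, gaussCoeff a b c n * x ^ n := rfl

lemma gaussCoeff_zero (a b c : ℂ) : gaussCoeff a b c 0 = 1 := by simp [gaussCoeff, poch]

lemma gaussCoeff_succ (a b : ℂ) {c : ℂ} (hc : ∀ n : ℕ, c + n ≠ 0) (n : ℕ) :
    gaussCoeff a b c (n + 1) = gaussCoeff a b c n * ((a + n) * (b + n) / ((c + n) * (n + 1))) := by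
  have h1 := hc n
  have h2 := poch_ne_zero hc n
  have h3 : (n : ℂ) + 1 ≠ 0 := Nat.cast_add_one_ne_zero n
  have h4 : (n.factorial : ℂ) ≠ 0 := Nat.cast_ne_zero.mpr n.factorial_ne_zero
  simp only [gaussCoeff, poch_succ, Nat.factorial_succ]
  push_cast
  field_simp

/-- Differentiating the hypergeometric series raises all parameters by one. -/
lemma succ_mul_gaussCoeff_succ (a b : ℂ) {c : ℂ} (hc : ∀ n : ℕ, c + n ≠ 0) (n : ℕ) :
    ((n : ℂ) + 1) * gaussCoeff a b c (n + 1) =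
      a * b / c * gaussCoeff (a + 1) (b + 1) (c + 1) n := by
  have h1 : c ≠ 0 := by simpa using hc 0
  have h2 : poch (c + 1) n ≠ 0 := poch_ne_zero (fun m => by
    have := hc (m + 1); push_cast at this; rwa [add_assoc, add_comm 1]) n
  have h3 : (n : ℂ) + 1 ≠ 0 := Nat.cast_add_one_ne_zero n
  have h4 : (n.factorial : ℂ) ≠ 0 := Nat.cast_ne_zero.mpr n.factorial_ne_zero
  simp only [gaussCoeff, poch_succ', Nat.factorial_succ]
  push_cast
  field_simp

lemma gaussCoeff_ne_zero {a b c : ℂ} (ha : ∀ n : ℕ, a + n ≠ 0) (hb : ∀ n : ℕ, b + n ≠ 0)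
    (hc : ∀ n : ℕ, c + n ≠ 0) (n : ℕ) : gaussCoeff a b c n ≠ 0 :=
  div_ne_zero (mul_ne_zero (poch_ne_zero ha n) (poch_ne_zero hb n))
    (mul_ne_zero (poch_ne_zero hc n) (Nat.cast_ne_zero.mpr n.factorial_ne_zero))

lemma summable_gaussCoeff {a b c : ℂ} (ha : ∀ n : ℕ, a + n ≠ 0) (hb : ∀ n : ℕ, b + n ≠ 0)
    (hc : ∀ n : ℕ, c + n ≠ 0) {x : ℂ} (hx : ‖x‖ < 1) :
    Summable fun n => gaussCoeff a b c n * x ^ n := by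
  rcases eq_or_ne x 0 with rfl | hx0
  · exact summable_of_ne_finset_zero (s := {0}) fun n hn => by
      simp [zero_pow (by simpa using hn : n ≠ 0)]
  refine summable_of_ratio_test_tendsto_lt_one hx
    (.of_forall fun n => mul_ne_zero (gaussCoeff_ne_zero ha hb hc n) (pow_ne_zero _ hx0)) ?_
  have h1 : Tendsto (fun n : ℕ => (a + n) / (c + n)) atTop (nhds 1) := by
    simpa using tendsto_add_mul_div_add_mul_atTop_nhds a c (1 : ℂ) one_ne_zero
  have h2 : Tendsto (fun n : ℕ => (b + n) / (1 + n)) atTop (nhds 1) := by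
    simpa using tendsto_add_mul_div_add_mul_atTop_nhds b 1 (1 : ℂ) one_ne_zero
  have h3 := ((h1.mul h2).mul_const x).norm
  simp only [one_mul] at h3
  refine h3.congr fun n => ?_
  have hg := gaussCoeff_ne_zero ha hb hc n
  have hn := hc n
  have h4 : (n : ℂ) + 1 ≠ 0 := Nat.cast_add_one_ne_zero n
  have h5 : (1 : ℂ) + n ≠ 0 := by rwa [add_comm]
  rw [← norm_div, gaussCoeff_succ a b hc]
  congr 1
  field_simp
  ring

/-- Termwise differentiation of a power series converging on the unit disc. -/
lemma hasDerivAt_tsum_mul_pow {t : ℕ → ℂ}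
    (ht : ∀ x : ℂ, ‖x‖ < 1 → Summable fun n => t n * x ^ n) {x : ℂ} (hx : ‖x‖ < 1) :
    HasSum (fun n : ℕ => ((n : ℂ) + 1) * t (n + 1) * x ^ n)
        (deriv (fun y => ∑' n, t n * y ^ n) x) ∧
      HasDerivAt (fun y => ∑' n, t n * y ^ n) (deriv (fun y => ∑' n, t n * y ^ n) x) x := by
  obtain ⟨r, hxr, hr⟩ := exists_between hx
  have hr0 : 0 ≤ r := (norm_nonneg x).trans hxr.le
  have hu : Summable fun n => ‖t n * (r : ℂ) ^ n‖ :=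
    (ht r (by simpa [abs_of_nonneg hr0] using hr)).norm
  have hd : ∀ n : ℕ, DifferentiableOn ℂ (fun y : ℂ => t n * y ^ n) (Metric.ball 0 r) :=
    fun n => by fun_prop
  have hle : ∀ (n : ℕ) (w : ℂ), w ∈ Metric.ball (0 : ℂ) r →
      ‖t n * w ^ n‖ ≤ ‖t n * (r : ℂ) ^ n‖ := fun n w hw => by
    have hw' : ‖w‖ ≤ r := by simpa using (mem_ball_zero_iff.mp hw).le
    simp only [norm_mul, norm_pow, Complex.norm_real, Real.norm_eq_abs, abs_of_nonneg hr0]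
    gcongr
  have hxm : x ∈ Metric.ball (0 : ℂ) r := mem_ball_zero_iff.mpr hxr
  have hs := Complex.hasSum_deriv_of_summable_norm hu hd Metric.isOpen_ball hle hxm
  have hD := Complex.differentiableOn_tsum_of_summable_norm hu hd Metric.isOpen_ball hle
  refine ⟨?_, (hD.differentiableAt (Metric.isOpen_ball.mem_nhds hxm)).hasDerivAt⟩
  have := (hasSum_nat_add_iff' 1).mpr hs
  simp only [Finset.sum_range_one, pow_zero, deriv_const, sub_zero] at this
  refine this.congr_fun fun n => ?_
  rw [deriv_const_mul_field, deriv_pow_field]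
  push_cast
  ring

lemma hasDerivAt_F21 {a b c : ℂ} (ha : ∀ n : ℕ, a + n ≠ 0) (hb : ∀ n : ℕ, b + n ≠ 0)
    (hc : ∀ n : ℕ, c + n ≠ 0) {x : ℂ} (hx : ‖x‖ < 1) :
    HasDerivAt (F21 a b c) (a * b / c * F21 (a + 1) (b + 1) (c + 1) x) x := by
  obtain ⟨h1, h2⟩ := hasDerivAt_tsum_mul_pow (fun x hx => summable_gaussCoeff ha hb hc hx) hx
  convert! h2 using 1
  rw [← h1.tsum_eq, F21_eq_tsum, ← tsum_mul_left]
  refine tsum_congr fun n => ?_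
  rw [succ_mul_gaussCoeff_succ a b hc]
  ring

lemma add_one_add_nat_ne_zero {a : ℂ} (ha : ∀ n : ℕ, a + n ≠ 0) (n : ℕ) : a + 1 + n ≠ 0 := by
  have := ha (n + 1)
  push_cast at this
  rwa [add_assoc, add_comm 1]

/-- Gauss's hypergeometric differential equation. -/
lemma F21_gauss_ode {a b c : ℂ} (ha : ∀ n : ℕ, a + n ≠ 0) (hb : ∀ n : ℕ, b + n ≠ 0)
    (hc : ∀ n : ℕ, c + n ≠ 0) {x : ℂ} (hx : ‖x‖ < 1) :
    x * (1 - x) * (a * b / c * ((a + 1) * (b + 1) / (c + 1) *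
        F21 (a + 1 + 1) (b + 1 + 1) (c + 1 + 1) x)) +
      (c - (a + b + 1) * x) * (a * b / c * F21 (a + 1) (b + 1) (c + 1) x) -
      a * b * F21 a b c x = 0 := by
  have ha1 := add_one_add_nat_ne_zero ha
  have hb1 := add_one_add_nat_ne_zero hb
  have hc1 := add_one_add_nat_ne_zero hc
  set t := gaussCoeff a b c with ht
  have h0 : HasSum (fun n => t n * x ^ n) (F21 a b c x) := (summable_gaussCoeff ha hb hc hx).hasSum
  have h1 : HasSum (fun n : ℕ => ((n : ℂ) + 1) * t (n + 1) * x ^ n)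
      (a * b / c * F21 (a + 1) (b + 1) (c + 1) x) := by
    refine ((summable_gaussCoeff ha1 hb1 hc1 hx).hasSum.mul_left (a * b / c)).congr_fun fun n => ?_
    rw [ht, succ_mul_gaussCoeff_succ a b hc]
    ring
  have h2 : HasSum (fun n : ℕ => ((n : ℂ) + 1) * ((n : ℂ) + 2) * t (n + 2) * x ^ n)
      (a * b / c * ((a + 1) * (b + 1) / (c + 1) * F21 (a + 1 + 1) (b + 1 + 1) (c + 1 + 1) x)) := by
    refine (((summable_gaussCoeff (add_one_add_nat_ne_zero ha1) (add_one_add_nat_ne_zero hb1)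
      (add_one_add_nat_ne_zero hc1) hx).hasSum.mul_left ((a + 1) * (b + 1) / (c + 1))).mul_left
      (a * b / c)).congr_fun fun n => ?_
    have e1 := succ_mul_gaussCoeff_succ a b hc (n + 1)
    have e2 := succ_mul_gaussCoeff_succ (a + 1) (b + 1) hc1 n
    push_cast at e1
    linear_combination ((n : ℂ) + 1) * x ^ n * e1 + a * b / c * x ^ n * e2
  generalize F21 a b c x = f0 at *
  generalize a * b / c * F21 (a + 1) (b + 1) (c + 1) x = f1 at *
  generalize a * b / c * ((a + 1) * (b + 1) / (c + 1) *
    F21 (a + 1 + 1) (b + 1 + 1) (c + 1 + 1) x) = f2 at *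
  have k1 : HasSum (fun n : ℕ => (n : ℂ) * t n * x ^ n) (x * f1) := by
    refine (hasSum_nat_add_iff' 1).mp ?_
    simp only [Finset.sum_range_one, Nat.cast_zero, zero_mul, sub_zero]
    refine (h1.mul_left x).congr_fun fun n => ?_
    push_cast
    ring
  have k2 : HasSum (fun n : ℕ => (n : ℂ) * (n + 1) * t (n + 1) * x ^ n) (x * f2) := by
    refine (hasSum_nat_add_iff' 1).mp ?_
    simp only [Finset.sum_range_one, Nat.cast_zero, zero_mul, sub_zero]
    refine (h2.mul_left x).congr_fun fun n => ?_
    push_cast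
    ring
  have k3 : HasSum (fun n : ℕ => (n : ℂ) * (n - 1) * t n * x ^ n) (x * (x * f2)) := by
    refine (hasSum_nat_add_iff' 1).mp ?_
    simp only [Finset.sum_range_one, Nat.cast_zero, zero_mul, sub_zero]
    refine (k2.mul_left x).congr_fun fun n => ?_
    push_cast
    ring
  have key := (((k2.sub k3).add (h1.mul_left c)).sub (k1.mul_left (a + b + 1))).sub
    (h0.mul_left (a * b))
  have hz : HasSum (fun _ : ℕ => (0 : ℂ)) 0 := hasSum_zero
  have := key.unique (hz.congr_fun fun n => ?_)
  · linear_combination this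
  · have h3 := hc n
    have h4 : (n : ℂ) + 1 ≠ 0 := Nat.cast_add_one_ne_zero n
    rw [ht, gaussCoeff_succ a b hc]
    field_simp
    ring

/-- Leading coefficient of the `j`-th derivative of `z ↦ cos (μ arccos z)` at `z = 1`. -/
noncomputable def cosArccosCoeff (μ : ℂ) : ℕ → ℂ
  | 0 => 1
  | j + 1 => cosArccosCoeff μ j * ((j - μ) * (j + μ) / (j + 1 / 2) * (-1 / 2))

/-- The `j`-th derivative of `z ↦ cos (μ arccos z)`, as a hypergeometric function. -/
noncomputable def cosArccosDeriv (μ : ℂ) (j : ℕ) (z : ℝ) : ℂ :=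
  cosArccosCoeff μ j * F21 (j - μ) (j + μ) (j + 1 / 2) ((1 - z) / 2)

section cosArccosDeriv

variable {μ : ℂ}

lemma nat_sub_add_nat_ne_zero (hμ : ∀ m : ℤ, μ ≠ m) (j n : ℕ) : (j : ℂ) - μ + n ≠ 0 := fun h =>
  hμ (j + n) (by push_cast; linear_combination -h)

lemma nat_add_add_nat_ne_zero (hμ : ∀ m : ℤ, μ ≠ m) (j n : ℕ) : (j : ℂ) + μ + n ≠ 0 := fun h =>
  hμ (-(j + n)) (by push_cast; linear_combination h)

lemma nat_add_half_add_nat_ne_zero (j n : ℕ) : (j : ℂ) + 1 / 2 + n ≠ 0 := by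
  have : (j : ℝ) + 1 / 2 + n ≠ 0 := by positivity
  have h := Complex.ofReal_ne_zero.mpr this
  push_cast at h
  exact h

lemma norm_one_sub_div_two_lt_one {z : ℝ} (h1 : -1 < z) (h2 : z < 3) :
    ‖(1 - (z : ℂ)) / 2‖ < 1 := by
  have : (1 - (z : ℂ)) / 2 = ((1 - z) / 2 : ℝ) := by push_cast; rfl
  rw [this, Complex.norm_real, Real.norm_eq_abs, abs_lt]
  constructor <;> linarith

lemma hasDerivAt_cosArccosDeriv (hμ : ∀ m : ℤ, μ ≠ m) (j : ℕ) {z : ℝ} (h1 : -1 < z)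
    (h2 : z < 3) :
    HasDerivAt (cosArccosDeriv μ j) (cosArccosDeriv μ (j + 1) z) z := by
  have hF := hasDerivAt_F21 (nat_sub_add_nat_ne_zero hμ j) (nat_add_add_nat_ne_zero hμ j)
    (nat_add_half_add_nat_ne_zero j) (norm_one_sub_div_two_lt_one h1 h2)
  have hz : HasDerivAt (fun y : ℝ => (1 - (y : ℂ)) / 2) (-1 / 2) z :=
    ((Complex.ofRealCLM.hasDerivAt (x := z)).const_sub 1).div_const 2
  have := (HasDerivAt.scomp z hF hz).const_mul (cosArccosCoeff μ j)
  convert! this using 1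
  simp only [cosArccosDeriv, cosArccosCoeff, Nat.cast_add_one, smul_eq_mul]
  rw [show (j : ℂ) - μ + 1 = j + 1 - μ by ring, show (j : ℂ) + μ + 1 = j + 1 + μ by ring,
    show (j : ℂ) + 1 / 2 + 1 = j + 1 + 1 / 2 by ring]
  ring

lemma cosArccosDeriv_ode (hμ : ∀ m : ℤ, μ ≠ m) (j : ℕ) {z : ℝ} (h1 : -1 < z) (h2 : z < 3) :
    (1 - (z : ℂ) ^ 2) * cosArccosDeriv μ (j + 2) z =
      (2 * j + 1) * z * cosArccosDeriv μ (j + 1) z + (j ^ 2 - μ ^ 2) * cosArccosDeriv μ j z := by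
  have key := F21_gauss_ode (nat_sub_add_nat_ne_zero hμ j) (nat_add_add_nat_ne_zero hμ j)
    (nat_add_half_add_nat_ne_zero j) (norm_one_sub_div_two_lt_one h1 h2)
  simp only [cosArccosDeriv, cosArccosCoeff, Nat.cast_add_one]
  rw [show (j : ℂ) - μ + 1 = j + 1 - μ by ring, show (j : ℂ) + μ + 1 = j + 1 + μ by ring,
    show (j : ℂ) + 1 / 2 + 1 = j + 1 + 1 / 2 by ring,
    show (j : ℂ) + 1 - μ + 1 = j + 1 + 1 - μ by ring, show (j : ℂ) + 1 + μ + 1 = j + 1 + 1 + μ by ring,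
    show (j : ℂ) + 1 + 1 / 2 + 1 = j + 1 + 1 + 1 / 2 by ring] at key
  linear_combination cosArccosCoeff μ j * key

lemma F21_zero (a b c : ℂ) : F21 a b c 0 = 1 := by
  rw [F21_eq_tsum, tsum_eq_single 0 fun n hn => by simp [hn]]
  simp [gaussCoeff_zero]

/-- `u(θ) = cosArccosDeriv μ 0 (cos θ)` solves `u'' = -μ² u`, `u(0) = 1`, `u'(0) = 0`. -/
lemma cosArccosDeriv_zero_cos (hμ : ∀ m : ℤ, μ ≠ m) {θ : ℝ}
    (hθ : θ ∈ Set.Ioo (-Real.pi) Real.pi) :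
    cosArccosDeriv μ 0 (Real.cos θ) = Complex.cos (μ * θ) := by
  have hμ0 : μ ≠ 0 := by simpa using hμ 0
  have hcos : ∀ t ∈ Set.Ioo (-Real.pi) Real.pi, -1 < Real.cos t := fun t ht => by
    rw [← Real.cos_abs t, ← Real.cos_pi]
    exact Real.cos_lt_cos_of_nonneg_of_le_pi (abs_nonneg t) le_rfl (abs_lt.mpr ht)
  have hY : ∀ (j : ℕ), ∀ t ∈ Set.Ioo (-Real.pi) Real.pi,
      HasDerivAt (fun t => cosArccosDeriv μ j (Real.cos t))
        (-(Real.sin t : ℂ) * cosArccosDeriv μ (j + 1) (Real.cos t)) t := fun j t ht => by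
    have := HasDerivAt.scomp t (hasDerivAt_cosArccosDeriv hμ j (hcos t ht)
      ((Real.cos_le_one t).trans_lt (by norm_num))) (Real.hasDerivAt_cos t)
    convert! this using 1
    rw [Complex.real_smul]
    push_cast
    rfl
  have hlin : ∀ t : ℝ, HasDerivAt (fun t : ℝ => μ * (t : ℂ)) μ t := fun t => by
    simpa using (Complex.ofRealCLM.hasDerivAt (x := t)).const_mul μ
  have hc : ∀ t : ℝ, HasDerivAt (fun t : ℝ => Complex.cos (μ * t)) (-Complex.sin (μ * t) * μ) t :=
    fun t => (Complex.hasDerivAt_cos _).comp t (hlin t)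
  have hs : ∀ t : ℝ, HasDerivAt (fun t : ℝ => Complex.sin (μ * t)) (Complex.cos (μ * t) * μ) t :=
    fun t => (Complex.hasDerivAt_sin _).comp t (hlin t)
  have hsin : ∀ t : ℝ, HasDerivAt (fun t : ℝ => (Real.sin t : ℂ)) (Real.cos t : ℂ) t :=
    fun t => (Real.hasDerivAt_sin t).ofReal_comp
  let A : ℝ → ℂ := fun t => μ * cosArccosDeriv μ 0 (Real.cos t) * Complex.cos (μ * t) +
    Real.sin t * cosArccosDeriv μ 1 (Real.cos t) * Complex.sin (μ * t)
  let B : ℝ → ℂ := fun t => μ * cosArccosDeriv μ 0 (Real.cos t) * Complex.sin (μ * t) -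
    Real.sin t * cosArccosDeriv μ 1 (Real.cos t) * Complex.cos (μ * t)
  have hode : ∀ t ∈ Set.Ioo (-Real.pi) Real.pi,
      (Real.sin t : ℂ) ^ 2 * cosArccosDeriv μ 2 (Real.cos t) =
        Real.cos t * cosArccosDeriv μ 1 (Real.cos t) -
          μ ^ 2 * cosArccosDeriv μ 0 (Real.cos t) := fun t ht => by
    have h := cosArccosDeriv_ode hμ 0 (hcos t ht) ((Real.cos_le_one t).trans_lt (by norm_num))
    have h2 : (Real.sin t : ℂ) ^ 2 = 1 - (Real.cos t : ℂ) ^ 2 := by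
      exact_mod_cast Real.sin_sq t
    simp only [Nat.cast_zero, zero_add] at h
    rw [h2, h]
    ring
  have hA : ∀ t ∈ Set.Ioo (-Real.pi) Real.pi, HasDerivAt A 0 t := fun t ht => by
    have := ((((hY 0 t ht).const_mul μ).mul (hc t))).add (((hsin t).mul (hY 1 t ht)).mul (hs t))
    convert! this using 1
    simp only [zero_add, Nat.reduceAdd, Pi.mul_apply]
    linear_combination Complex.sin (μ * t) * hode t ht
  have hB : ∀ t ∈ Set.Ioo (-Real.pi) Real.pi, HasDerivAt B 0 t := fun t ht => by
    have := ((((hY 0 t ht).const_mul μ).mul (hs t))).sub (((hsin t).mul (hY 1 t ht)).mul (hc t))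
    convert! this using 1
    simp only [zero_add, Nat.reduceAdd, Pi.mul_apply]
    linear_combination -Complex.cos (μ * t) * hode t ht
  have h0 : (0 : ℝ) ∈ Set.Ioo (-Real.pi) Real.pi := by constructor <;> linarith [Real.pi_pos]
  have hconst : ∀ f : ℝ → ℂ, (∀ t ∈ Set.Ioo (-Real.pi) Real.pi, HasDerivAt f 0 t) → f θ = f 0 :=
    fun f hf => isOpen_Ioo.is_const_of_deriv_eq_zero isPreconnected_Ioo
      (fun t ht => (hf t ht).differentiableAt.differentiableWithinAt)
      (fun t ht => (hf t ht).deriv) hθ h0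
  have hA' := hconst A hA
  have hB' := hconst B hB
  have h1 : cosArccosDeriv μ 0 1 = 1 := by simp [cosArccosDeriv, cosArccosCoeff, F21_zero]
  simp only [A, B, Real.cos_zero, Real.sin_zero, h1, Complex.ofReal_zero, mul_zero, zero_mul,
    Complex.cos_zero, Complex.sin_zero, mul_one, add_zero, sub_zero] at hA' hB'
  refine mul_left_cancel₀ hμ0 ?_
  linear_combination Complex.cos (μ * θ) * hA' + Complex.sin (μ * θ) * hB' -
    μ * cosArccosDeriv μ 0 (Real.cos θ) * Complex.sin_sq_add_cos_sq (μ * θ)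

lemma cosArccosDeriv_zero (hμ : ∀ m : ℤ, μ ≠ m) {z : ℝ} (hz : z ∈ Set.Ioo (-1 : ℝ) 1) :
    cosArccosDeriv μ 0 z = Complex.cos (μ * Real.arccos z) := by
  conv_lhs => rw [← Real.cos_arccos hz.1.le hz.2.le]
  refine cosArccosDeriv_zero_cos hμ ⟨?_, ?_⟩
  · linarith [Real.arccos_nonneg z, Real.pi_pos]
  · exact lt_of_le_of_ne (Real.arccos_le_pi z) fun h => by
      linarith [hz.1, Real.arccos_eq_pi.mp h]

lemma cosArccosDeriv_one (hμ : ∀ m : ℤ, μ ≠ m) {z : ℝ} (hz : z ∈ Set.Ioo (-1 : ℝ) 1) :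
    cosArccosDeriv μ 1 z = μ * Complex.sin (μ * Real.arccos z) / √(1 - z ^ 2) := by
  have h1 := hasDerivAt_cosArccosDeriv hμ 0 hz.1 (hz.2.trans (by norm_num))
  have h2 : HasDerivAt (fun y : ℝ => Complex.cos (μ * Real.arccos y))
      (-Complex.sin (μ * Real.arccos z) * (μ * (-(1 / √(1 - z ^ 2)) : ℝ))) z :=
    (Complex.hasDerivAt_cos _).comp z
      (((Real.hasDerivAt_arccos hz.1.ne' hz.2.ne).ofReal_comp).const_mul μ)
  have h3 : cosArccosDeriv μ 0 =ᶠ[nhds z] fun y : ℝ => Complex.cos (μ * Real.arccos y) :=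
    eventually_of_mem (isOpen_Ioo.mem_nhds hz) fun y hy => cosArccosDeriv_zero hμ hy
  rw [(h1.congr_of_eventuallyEq h3.symm).unique h2]
  push_cast
  ring

lemma norm_cos_le_exp_abs_im (w : ℂ) : ‖Complex.cos w‖ ≤ Real.exp |w.im| := by
  rw [Complex.cos, norm_div]
  have h1 : ‖Complex.exp (w * Complex.I)‖ ≤ Real.exp |w.im| := by
    rw [Complex.norm_exp]; simpa using neg_le_abs w.im
  have h2 : ‖Complex.exp (-w * Complex.I)‖ ≤ Real.exp |w.im| := by
    rw [Complex.norm_exp]; simpa using le_abs_self w.im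
  have := norm_add_le (Complex.exp (w * Complex.I)) (Complex.exp (-w * Complex.I))
  rw [Complex.norm_two]
  linarith

lemma norm_sin_le_exp_abs_im (w : ℂ) : ‖Complex.sin w‖ ≤ Real.exp |w.im| := by
  rw [← Complex.cos_sub_pi_div_two]
  simpa [← Complex.ofReal_ofNat, ← Complex.ofReal_div] using
    norm_cos_le_exp_abs_im (w - Real.pi / 2)

/-- Bounds for the derivatives, polynomial in `μ` as long as `μ.im` stays bounded. -/
lemma exists_norm_cosArccosDeriv_le (b : ℝ) {r : ℝ} (hr0 : 0 < r) (hr : r < 1) (j : ℕ) :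
    ∃ C, 0 ≤ C ∧ ∀ μ : ℂ, (∀ m : ℤ, μ ≠ m) → |μ.im| ≤ b → ∀ z ∈ Set.Ioo (-r) r,
      ‖cosArccosDeriv μ j z‖ ≤ C * (1 + ‖μ‖) ^ j := by
  have hr2 : 0 < 1 - r ^ 2 := by nlinarith
  have hz1 : ∀ z ∈ Set.Ioo (-r) r, z ∈ Set.Ioo (-1 : ℝ) 1 := fun z hz =>
    ⟨by linarith [hz.1], by linarith [hz.2]⟩
  have hz2 : ∀ z ∈ Set.Ioo (-r) r, 1 - r ^ 2 ≤ 1 - z ^ 2 := fun z hz => by nlinarith [hz.1, hz.2]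
  have him : ∀ (μ : ℂ) (z : ℝ), |μ.im| ≤ b →
      Real.exp |(μ * (Real.arccos z : ℂ)).im| ≤ Real.exp (b * Real.pi) := fun μ z hμ => by
    rw [Complex.im_mul_ofReal, abs_mul, abs_of_nonneg (Real.arccos_nonneg z)]
    exact Real.exp_le_exp.mpr (mul_le_mul hμ (Real.arccos_le_pi z) (Real.arccos_nonneg z)
      ((abs_nonneg _).trans hμ))
  induction j using Nat.twoStepInduction with
  | zero =>
    refine ⟨Real.exp (b * Real.pi), (Real.exp_pos _).le, fun μ hμ hb z hz => ?_⟩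
    rw [cosArccosDeriv_zero hμ (hz1 z hz), pow_zero, mul_one]
    exact (norm_cos_le_exp_abs_im _).trans (him μ z hb)
  | one =>
    refine ⟨Real.exp (b * Real.pi) / √(1 - r ^ 2), by positivity, fun μ hμ hb z hz => ?_⟩
    rw [cosArccosDeriv_one hμ (hz1 z hz), norm_div, norm_mul, Complex.norm_real, Real.norm_eq_abs,
      abs_of_nonneg (Real.sqrt_nonneg _), pow_one]
    have h1 := (norm_sin_le_exp_abs_im _).trans (him μ z hb)
    have h2 := Real.sqrt_le_sqrt (hz2 z hz)
    have h3 := Real.sqrt_pos.mpr hr2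
    calc ‖μ‖ * ‖Complex.sin (μ * Real.arccos z)‖ / √(1 - z ^ 2)
        ≤ (1 + ‖μ‖) * Real.exp (b * Real.pi) / √(1 - r ^ 2) := by
          gcongr
          linarith
      _ = _ := by ring
  | more j ih0 ih1 =>
    obtain ⟨C0, hC0, h0⟩ := ih0
    obtain ⟨C1, hC1, h1⟩ := ih1
    refine ⟨((2 * j + 1) * C1 + (j ^ 2 + 1) * C0) / (1 - r ^ 2), by positivity,
      fun μ hμ hb z hz => ?_⟩
    have hode := cosArccosDeriv_ode hμ j (hz1 z hz).1 ((hz1 z hz).2.trans (by norm_num))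
    have hzz : (0 : ℝ) < 1 - z ^ 2 := hr2.trans_le (hz2 z hz)
    have habs : |z| ≤ 1 := (abs_lt.mpr (hz1 z hz)).le
    have hn : ‖1 - (z : ℂ) ^ 2‖ = 1 - z ^ 2 := by
      rw [← Complex.ofReal_pow, ← Complex.ofReal_one, ← Complex.ofReal_sub, Complex.norm_real,
        Real.norm_eq_abs, abs_of_pos hzz]
    have e1 := h1 μ hμ hb z hz
    have e0 := h0 μ hμ hb z hz
    have hm := norm_nonneg μ
    have f1 : ‖(2 * (j : ℂ) + 1) * z * cosArccosDeriv μ (j + 1) z‖ ≤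
        (2 * j + 1) * 1 * (C1 * (1 + ‖μ‖) ^ (j + 2)) := by
      rw [norm_mul, norm_mul, Complex.norm_real, Real.norm_eq_abs]
      have : ‖2 * (j : ℂ) + 1‖ = 2 * j + 1 := by
        have := Complex.norm_natCast (2 * j + 1)
        push_cast at this
        exact this
      rw [this]
      gcongr
      refine e1.trans ?_
      gcongr <;> linarith
    have f0 : ‖((j : ℂ) ^ 2 - μ ^ 2) * cosArccosDeriv μ j z‖ ≤
        ((j ^ 2 + 1) * (1 + ‖μ‖) ^ 2) * (C0 * (1 + ‖μ‖) ^ j) := by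
      rw [norm_mul]
      gcongr
      refine (norm_sub_le _ _).trans ?_
      rw [norm_pow, norm_pow, Complex.norm_natCast]
      nlinarith [sq_nonneg (j : ℝ), mul_nonneg (sq_nonneg (j : ℝ)) hm,
        mul_nonneg (sq_nonneg (j : ℝ)) (sq_nonneg ‖μ‖)]
    have := congrArg norm hode
    rw [norm_mul, hn] at this
    have h4 : (1 - r ^ 2) * ‖cosArccosDeriv μ (j + 2) z‖ ≤
        ((2 * j + 1) * C1 + (j ^ 2 + 1) * C0) * (1 + ‖μ‖) ^ (j + 2) :=
      calc _ ≤ (1 - z ^ 2) * ‖cosArccosDeriv μ (j + 2) z‖ := by gcongr ?_ * _; exact hz2 z hz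
        _ ≤ _ := this.le.trans (norm_add_le _ _)
        _ ≤ _ := add_le_add f1 f0
        _ = _ := by ring
    rw [div_mul_eq_mul_div, le_div_iff₀ hr2]
    linarith

end cosArccosDeriv

lemma cosArccosCoeff_mul_Gamma {μ : ℂ} (hμ : ∀ m : ℤ, μ ≠ m) (j : ℕ) :
    cosArccosCoeff μ j * ((2 * j).factorial * Complex.Gamma (μ - j + 1)) =
      μ * 2 ^ j * j.factorial * Complex.Gamma (μ + j) := by
  induction j with
  | zero =>
    simp [cosArccosCoeff, Complex.Gamma_add_one μ (by simpa using hμ 0)]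
  | succ j ih =>
    have h1 : μ - j ≠ 0 := sub_ne_zero.mpr (by simpa using hμ j)
    have h2 : μ + j ≠ 0 := fun h => hμ (-j) (by push_cast; linear_combination h)
    have h3 : (j : ℂ) + 1 / 2 ≠ 0 := by simpa using nat_add_half_add_nat_ne_zero j 0
    rw [Complex.Gamma_add_one _ h1] at ih
    rw [show 2 * (j + 1) = 2 * j + 1 + 1 by ring]
    simp only [cosArccosCoeff, Nat.factorial_succ, Nat.cast_add_one, Nat.cast_mul]
    rw [show μ - ((j : ℂ) + 1) + 1 = μ - j by ring, ← add_assoc, Complex.Gamma_add_one _ h2]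
    have h5 : ((j : ℂ) - μ) * (j + μ) / (j + 1 / 2) * (-1 / 2) * (2 * j + 1) =
        (μ - j) * (μ + j) := by
      rw [div_mul_eq_mul_div, div_mul_eq_mul_div, div_eq_iff h3]
      ring
    linear_combination cosArccosCoeff μ j * (2 * j + 1 + 1) * (2 * j).factorial *
      Complex.Gamma (μ - j) * h5 + 2 * (j + 1) * (μ + j) * ih

/-- In even dimension the Legendre function is a derivative of `cos (μ arccos z) / μ`. -/
lemma legP_eq_cosArccosDeriv {μ : ℂ} (hμ : ∀ m : ℤ, μ ≠ m) (k : ℕ) (z : ℝ) :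
    legP z (μ - k) (2 * k + 2) =
      1 / (2 ^ k * (k.factorial : ℂ)) * (cosArccosDeriv μ k z / μ) := by
  have h0 : μ ≠ 0 := by simpa using hμ 0
  have h1 : Complex.Gamma (μ - k + 1) ≠ 0 := Complex.Gamma_ne_zero fun m hm =>
    hμ (k - 1 - m) (by push_cast; linear_combination hm)
  have h2 : (k.factorial : ℂ) ≠ 0 := Nat.cast_ne_zero.mpr k.factorial_ne_zero
  have h3 : ((2 * k).factorial : ℂ) ≠ 0 := Nat.cast_ne_zero.mpr (2 * k).factorial_ne_zero
  have key := cosArccosCoeff_mul_Gamma hμ k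
  have h4 : Complex.Gamma (((2 * k + 2 : ℕ) : ℂ) - 1) = (2 * k).factorial := by
    rw [← Complex.Gamma_nat_eq_factorial]
    push_cast
    congr 1
    ring
  rw [legP, h4, cosArccosDeriv]
  push_cast
  rw [show μ - k + (2 * k + 2) - 2 = μ + (k : ℂ) by ring, neg_sub, add_comm μ,
    show (2 * (k : ℂ) + 2 - 1) / 2 = k + 1 / 2 by ring]
  rw [add_comm μ] at key
  generalize F21 (k - μ) (k + μ) (k + 1 / 2) ((1 - z) / 2) = F
  field_simp
  linear_combination -F * key

lemma hasSum_F21_one {d : ℂ} (hd : ∀ n : ℕ, d + n ≠ 0) {x : ℂ} (hx : ‖x‖ < 1) :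
    HasSum (fun n : ℕ => d / (d + n) * x ^ n) (F21 d 1 (1 + d) x) := by
  have hc : ∀ n : ℕ, 1 + d + n ≠ 0 := add_comm d 1 ▸ add_one_add_nat_ne_zero hd
  have h1 : ∀ n : ℕ, (1 : ℂ) + n ≠ 0 := fun n => by
    rw [add_comm]; exact Nat.cast_add_one_ne_zero n
  refine (summable_gaussCoeff hd h1 hc hx).hasSum.congr_fun fun n => ?_
  congr 1
  induction n with
  | zero => simp [gaussCoeff_zero, div_self (by simpa using hd 0 : d ≠ 0)]
  | succ n ih =>
    have h2 := hd n
    have h3 := hd (n + 1)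
    have h4 := hc n
    have h5 := h1 n
    push_cast at h3
    rw [gaussCoeff_succ _ _ hc, ← ih]
    push_cast
    have h6 : (n : ℂ) + 1 ≠ 0 := Nat.cast_add_one_ne_zero n
    rw [show 1 + d + n = d + (n + 1) by ring, add_comm (1 : ℂ) n]
    field_simp

/-- The generating function in `β = arccos z`, expanded in powers of `h`. -/
lemma hasSum_cos_mul_arccos {d : ℂ} (hd : ∀ n : ℕ, d + n ≠ 0) {h : ℂ} (hh : ‖h‖ < 1) (β : ℝ) :
    HasSum (fun l : ℕ => h ^ l / (l + d) * Complex.cos ((l + d) * β))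
      ((1 / (2 * d)) *
        (Complex.exp (Complex.I * d * β) * F21 d 1 (1 + d) (h * Complex.exp (Complex.I * β)) +
          Complex.exp (-(Complex.I * d * β)) *
            F21 d 1 (1 + d) (h * Complex.exp (-(Complex.I * β))))) := by
  have hd0 : d ≠ 0 := by simpa using hd 0
  have hn1 : ‖h * Complex.exp (Complex.I * β)‖ < 1 := by
    simpa [mul_comm Complex.I, Complex.norm_exp_ofReal_mul_I] using hh
  have hn2 : ‖h * Complex.exp (-(Complex.I * β))‖ < 1 := by
    have : -(Complex.I * β) = ((-β : ℝ) : ℂ) * Complex.I := by push_cast; ring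
    rw [this, norm_mul, Complex.norm_exp_ofReal_mul_I, mul_one]
    exact hh
  refine ((((hasSum_F21_one hd hn1).mul_left _).add
    ((hasSum_F21_one hd hn2).mul_left _)).mul_left _).congr_fun fun l => ?_
  have h1 : (l : ℂ) + d ≠ 0 := by rw [add_comm]; exact hd l
  rw [Complex.cos, mul_pow, mul_pow, ← Complex.exp_nat_mul, ← Complex.exp_nat_mul,
    show (l + d) * (β : ℂ) * Complex.I = Complex.I * d * β + l * (Complex.I * β) by ring,
    show -((l + d) * (β : ℂ)) * Complex.I = -(Complex.I * d * β) + l * -(Complex.I * β) by ring,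
    Complex.exp_add, Complex.exp_add, add_comm d]
  field_simp

lemma bddAbove_norm_inv_nat_add (d : ℂ) :
    BddAbove (Set.range fun l : ℕ => ‖((l : ℂ) + d)⁻¹‖) := by
  have h1 : Tendsto (fun l : ℕ => ‖(l : ℂ) + d‖) atTop atTop := by
    refine tendsto_atTop_mono (fun l => ?_)
      (tendsto_atTop_add_const_right atTop (-‖d‖) tendsto_natCast_atTop_atTop)
    have := norm_sub_norm_le (l : ℂ) (-d)
    rw [Complex.norm_natCast, norm_neg, sub_neg_eq_add] at this
    linarith
  have h2 := tendsto_inv_atTop_zero.comp h1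
  simp only [norm_inv]
  exact h2.bddAbove_range

lemma summable_norm_pow_mul_add_pow (d : ℂ) {h : ℂ} (hh : ‖h‖ < 1) (j : ℕ) :
    Summable fun l : ℕ => ‖h‖ ^ l * (1 + ‖(l : ℂ) + d‖) ^ j := by
  have hs := ((summable_geometric_of_lt_one (norm_nonneg h) hh).mul_left ((1 + ‖d‖) ^ j)).add
    (summable_pow_mul_geometric_of_norm_lt_one j (r := ‖h‖) (by simpa using hh))
  refine Summable.of_nonneg_of_le (fun l => by positivity) (fun l => ?_)
    (hs.mul_left (2 ^ (j - 1)))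
  have h1 : 1 + ‖(l : ℂ) + d‖ ≤ (1 + ‖d‖) + l := by
    have := norm_add_le (l : ℂ) d
    rw [Complex.norm_natCast] at this
    linarith
  calc ‖h‖ ^ l * (1 + ‖(l : ℂ) + d‖) ^ j ≤ ‖h‖ ^ l * ((1 + ‖d‖) + l) ^ j := by gcongr
    _ ≤ ‖h‖ ^ l * (2 ^ (j - 1) * ((1 + ‖d‖) ^ j + (l : ℝ) ^ j)) := by
      gcongr
      exact add_pow_le (by positivity) (by positivity) j
    _ = _ := by ring

/-- Locally uniform domination of the differentiated generating series. -/
lemma exists_summable_norm_le {d : ℂ} (hd : ∀ (l : ℕ) (m : ℤ), (l : ℂ) + d ≠ m) {h : ℂ}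
    (hh : ‖h‖ < 1) (j : ℕ) {r : ℝ} (hr0 : 0 < r) (hr : r < 1) :
    ∃ u : ℕ → ℝ, Summable u ∧ ∀ (l : ℕ), ∀ z ∈ Set.Ioo (-r) r,
      ‖h ^ l / (l + d) * cosArccosDeriv (l + d) j z‖ ≤ u l := by
  obtain ⟨C, hC0, hC⟩ := exists_norm_cosArccosDeriv_le |d.im| hr0 hr j
  obtain ⟨c, hc⟩ := bddAbove_norm_inv_nat_add d
  refine ⟨_, (summable_norm_pow_mul_add_pow d hh j).mul_left (c * C), fun l z hz => ?_⟩
  have h1 : ‖((l : ℂ) + d)⁻¹‖ ≤ c := hc ⟨l, rfl⟩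
  have h2 := hC (l + d) (hd l) (by simp) z hz
  rw [div_eq_mul_inv, norm_mul, norm_mul, norm_pow]
  calc ‖h‖ ^ l * ‖((l : ℂ) + d)⁻¹‖ * ‖cosArccosDeriv (l + d) j z‖
      ≤ ‖h‖ ^ l * c * (C * (1 + ‖(l : ℂ) + d‖) ^ j) := by
        have : 0 ≤ c := (norm_nonneg _).trans h1
        gcongr
    _ = _ := by ring

lemma exists_mem_Ioo_neg_self {z : ℝ} (hz : z ∈ Set.Ioo (-1 : ℝ) 1) :
    ∃ r, 0 < r ∧ r < 1 ∧ z ∈ Set.Ioo (-r) r := by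
  obtain ⟨r, h1, h2⟩ := exists_between (abs_lt.mpr hz)
  exact ⟨r, (abs_nonneg z).trans_lt h1, h2, abs_lt.mp h1⟩

lemma summable_cosArccosDeriv {d : ℂ} (hd : ∀ (l : ℕ) (m : ℤ), (l : ℂ) + d ≠ m) {h : ℂ}
    (hh : ‖h‖ < 1) (j : ℕ) {z : ℝ} (hz : z ∈ Set.Ioo (-1 : ℝ) 1) :
    Summable fun l : ℕ => h ^ l / (l + d) * cosArccosDeriv (l + d) j z := by
  obtain ⟨r, hr0, hr, hzr⟩ := exists_mem_Ioo_neg_self hz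
  obtain ⟨u, hu, hle⟩ := exists_summable_norm_le hd hh j hr0 hr
  exact .of_norm_bounded hu fun l => hle l z hzr

lemma hasDerivAt_tsum_cosArccosDeriv {d : ℂ} (hd : ∀ (l : ℕ) (m : ℤ), (l : ℂ) + d ≠ m) {h : ℂ}
    (hh : ‖h‖ < 1) (j : ℕ) {z : ℝ} (hz : z ∈ Set.Ioo (-1 : ℝ) 1) :
    HasDerivAt (fun y : ℝ => ∑' l : ℕ, h ^ l / (l + d) * cosArccosDeriv (l + d) j y)
      (∑' l : ℕ, h ^ l / (l + d) * cosArccosDeriv (l + d) (j + 1) z) z := by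
  obtain ⟨r, hr0, hr, hzr⟩ := exists_mem_Ioo_neg_self hz
  obtain ⟨u, hu, hle⟩ := exists_summable_norm_le hd hh (j + 1) hr0 hr
  exact hasDerivAt_tsum_of_isPreconnected hu isOpen_Ioo isPreconnected_Ioo
    (fun l y hy => (hasDerivAt_cosArccosDeriv (hd l) j (by linarith [hy.1])
      (by linarith [hy.2])).const_mul _)
    hle hzr (summable_cosArccosDeriv hd hh j hz) hzr

lemma iteratedDeriv_eq_tsum_cosArccosDeriv {d : ℂ} (hd : ∀ (l : ℕ) (m : ℤ), (l : ℂ) + d ≠ m)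
    {h : ℂ} (hh : ‖h‖ < 1) {f : ℝ → ℂ}
    (hf : ∀ z ∈ Set.Ioo (-1 : ℝ) 1,
      f z = ∑' l : ℕ, h ^ l / (l + d) * cosArccosDeriv (l + d) 0 z)
    (j : ℕ) {z : ℝ} (hz : z ∈ Set.Ioo (-1 : ℝ) 1) :
    iteratedDeriv j f z = ∑' l : ℕ, h ^ l / (l + d) * cosArccosDeriv (l + d) j z := by
  induction j generalizing z with
  | zero => rw [iteratedDeriv_zero, hf z hz]
  | succ j ih =>
    have heq : iteratedDeriv j f =ᶠ[nhds z]
        fun y => ∑' l : ℕ, h ^ l / (l + d) * cosArccosDeriv (l + d) j y :=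
      eventually_of_mem (isOpen_Ioo.mem_nhds hz) fun y hy => ih hy
    rw [iteratedDeriv_succ, heq.deriv_eq]
    exact (hasDerivAt_tsum_cosArccosDeriv hd hh j hz).deriv

/-- Shifted generating-function formula in even dimensions `D ≥ 4`:
with `k = (D-2)/2`, `δ_D = δ + k`, `β ∈ (0,π)`, `z = cos β`, `|h| < 1`,
`Σ_l h^l P(z, l+δ, D) = (1/(2^k k!)) (d/dz)^k G(z)` where
`G(z) = (1/(2δ_D))(e^{iδ_D β} ₂F₁(δ_D,1;1+δ_D;h e^{iβ}) + e^{-iδ_D β} ₂F₁(δ_D,1;1+δ_D;h e^{-iβ}))`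
regarded as a function of `z` via `β = arccos z`. -/
theorem stmt2 (D : ℕ) (hD : 4 ≤ D) (hDeven : Even D) (k : ℕ) (hk : k = (D - 2) / 2)
    (δ : ℂ) (hδ : ∀ m : ℤ, δ ≠ m) (β : ℝ) (hβ : β ∈ Set.Ioo 0 Real.pi)
    (h : ℂ) (hh : ‖h‖ < 1) :
    Tendsto (fun N : ℕ => ∑ l ∈ Finset.range N, h ^ l * legP (Real.cos β : ℂ) ((l : ℂ) + δ) D)
      atTop
      (nhds ((1 / (2 ^ k * (k.factorial : ℂ))) *
        iteratedDeriv k (fun z : ℝ =>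
          (1 / (2 * (δ + k))) *
            (Complex.exp (Complex.I * (δ + k) * (Real.arccos z : ℂ)) *
                F21 (δ + k) 1 (1 + (δ + k)) (h * Complex.exp (Complex.I * (Real.arccos z : ℂ))) +
              Complex.exp (-(Complex.I * (δ + k) * (Real.arccos z : ℂ))) *
                F21 (δ + k) 1 (1 + (δ + k))
                  (h * Complex.exp (-(Complex.I * (Real.arccos z : ℂ))))))
          (Real.cos β))) := by
  obtain rfl : D = 2 * k + 2 := by
    obtain ⟨m, rfl⟩ := hDeven
    omega
  have hd : ∀ (l : ℕ) (m : ℤ), (l : ℂ) + (δ + k) ≠ m := fun l m hm =>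
    hδ (m - k - l) (by push_cast; linear_combination hm)
  have hd' : ∀ n : ℕ, δ + k + n ≠ 0 := fun n hn =>
    hd n 0 (by push_cast; linear_combination hn)
  have hz : Real.cos β ∈ Set.Ioo (-1 : ℝ) 1 := by
    rw [← Real.cos_pi, ← Real.cos_zero]
    exact ⟨Real.cos_lt_cos_of_nonneg_of_le_pi hβ.1.le le_rfl hβ.2,
      Real.cos_lt_cos_of_nonneg_of_le_pi le_rfl hβ.2.le hβ.1⟩
  rw [iteratedDeriv_eq_tsum_cosArccosDeriv hd hh (fun z hz => ?_) k hz]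
  · refine (((summable_cosArccosDeriv hd hh k hz).hasSum.mul_left _).congr_fun
      fun l => ?_).tendsto_sum_nat
    rw [show (l : ℂ) + δ = l + (δ + k) - k by ring, legP_eq_cosArccosDeriv (hd l)]
    ring
  · rw [← (hasSum_cos_mul_arccos hd' hh (Real.arccos z)).tsum_eq]
    exact tsum_congr fun l => by rw [cosArccosDeriv_zero (hd l) hz]
end

section
/- Let D ≥ 5 be an odd integer, set k = (D−3)/2, let δ ∈ ℂ \ ℤ and δ_D = δ + k, let z ∈ (−1,1) be real, and let h be real with 0 < h < 1. Define, as a function of z with h held fixed, S(z) = (1+h²−2hz)^{−1/2} · [ F1(−δ_D, δ_D, 1; 1; (1−z)/2, (1−t_−)/2) + δ_D·((t_− − z)/2)·F1(1−δ_D, 1+δ_D, 1; 2; (1−z)/2, (1−τ(t_+))/2) ], where t_± = (1 ± √(1+h²−2hz))/h and τ(t) = (1−tz)/(z−t) (so that t_± and τ(t_+) depend on z). Then the series Σ_{l=0}^∞ h^l P(z, l+δ, D) converges and Σ_{l=0}^∞ h^l P(z, l+δ, D) = (1/(D−2)!!) · (d/dz)^k S(z), where (D−2)!! = 3·5···(D−2).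 (Shifted generating-function formula in odd dimensions.) -/
open Filter

/-- Appell hypergeometric function `F1(a,b,b';c;x,y)` of two variables. -/
noncomputable def F1A (a b b' c x y : ℂ) : ℂ :=
  ∑' p : ℕ × ℕ, poch a (p.1 + p.2) * poch b p.1 * poch b' p.2 /
    (poch c (p.1 + p.2) * p.1.factorial * p.2.factorial) * x ^ p.1 * y ^ p.2

/-- The Taylor coefficient `(a)ₙ / n!` of `(1 - t)^(-a)`. -/
noncomputable def pochQ (a : ℂ) (n : ℕ) : ℂ := poch a n / n.factorial

lemma pochQ_zero (a : ℂ) : pochQ a 0 = 1 := by simp [pochQ, poch]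

lemma pochQ_succ (a : ℂ) (n : ℕ) : pochQ a (n + 1) = pochQ a n * (a + n) / (n + 1) := by
  have h1 : ((n : ℂ) + 1) ≠ 0 := by exact_mod_cast n.succ_ne_zero
  have h2 : (n.factorial : ℂ) ≠ 0 := by exact_mod_cast n.factorial_ne_zero
  simp only [pochQ, poch_succ, Nat.factorial_succ]
  push_cast
  field_simp

lemma pochQ_succ' (a : ℂ) (n : ℕ) : pochQ a (n + 1) = a * pochQ (a + 1) n / (n + 1) := by
  have h1 : ((n : ℂ) + 1) ≠ 0 := by exact_mod_cast n.succ_ne_zero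
  have h2 : (n.factorial : ℂ) ≠ 0 := by exact_mod_cast n.factorial_ne_zero
  simp only [pochQ, poch_succ', Nat.factorial_succ]
  push_cast
  field_simp

lemma add_mul_pochQ (a : ℂ) (n : ℕ) : (a + n) * pochQ a n = a * pochQ (a + 1) n := by
  have h1 : ((n : ℂ) + 1) ≠ 0 := by exact_mod_cast n.succ_ne_zero
  have h := (pochQ_succ a n).symm.trans (pochQ_succ' a n)
  field_simp at h
  linear_combination h

lemma pochQ_add_one_succ (a : ℂ) (n : ℕ) :
    pochQ (a + 1) (n + 1) = pochQ (a + 1) n + pochQ a (n + 1) := by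
  have h1 : ((n : ℂ) + 1) ≠ 0 := by exact_mod_cast n.succ_ne_zero
  rw [pochQ_succ, pochQ_succ']
  field_simp
  ring

lemma poch_one (n : ℕ) : poch 1 n = n.factorial := by
  induction n with
  | zero => simp [poch]
  | succ n ih => rw [poch_succ, ih, Nat.factorial_succ]; push_cast; ring

lemma poch_natCast_add_one (k n : ℕ) :
    poch ((k : ℂ) + 1) n * k.factorial = (n + k).factorial := by
  induction n with
  | zero => simp [poch]
  | succ n ih =>
    rw [poch_succ, show n + 1 + k = (n + k) + 1 by ring, Nat.factorial_succ]
    push_cast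
    linear_combination ((k : ℂ) + 1 + n) * ih

lemma norm_pochQ_le_choose {a : ℂ} {K : ℕ} (ha : ‖a‖ ≤ K + 1) (n : ℕ) :
    ‖pochQ a n‖ ≤ ((n + K).choose K : ℝ) := by
  induction n with
  | zero => simp [pochQ_zero]
  | succ n ih =>
    have h0 : (0 : ℝ) < (n : ℝ) + 1 := by positivity
    have h1 : ((n + 1 + K).choose K : ℝ) * (n + 1) = (n + K).choose K * (K + 1 + n) := by
      have := Nat.choose_mul_succ_eq (n + K) K
      have h2 : n + K + 1 - K = n + 1 := by omega
      rw [h2] at this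
      have h3 : n + 1 + K = n + K + 1 := by ring
      rw [h3]
      have h4 : (((n + K).choose K * (n + K + 1) : ℕ) : ℝ) =
        (((n + K + 1).choose K * (n + 1) : ℕ) : ℝ) := by rw [this]
      push_cast at h4
      linarith
    have hn : ‖((n : ℂ) + 1)‖ = n + 1 := by
      have := Complex.norm_natCast (n + 1)
      push_cast at this
      exact this
    rw [pochQ_succ, norm_div, norm_mul, hn, div_le_iff₀ h0, h1]
    have h5 : ‖a + n‖ ≤ K + 1 + n := by
      refine (norm_add_le _ _).trans ?_
      rw [Complex.norm_natCast]
      linarith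
    gcongr

lemma norm_pochQ_le {a : ℂ} {K : ℕ} (ha : ‖a‖ ≤ K + 1) {s : ℝ} (hs0 : 0 < s) (hs1 : s < 1)
    (n : ℕ) : ‖pochQ a n‖ ≤ (1 - s)⁻¹ ^ (K + 1) * s⁻¹ ^ n := by
  have hs : ‖s‖ < 1 := by rw [Real.norm_of_nonneg hs0.le]; exact hs1
  have h := hasSum_choose_mul_geometric_of_norm_lt_one (𝕜 := ℝ) K hs
  have h2 := le_hasSum h n fun i _ => by positivity
  rw [inv_pow, inv_pow, ← div_eq_mul_inv, le_div_iff₀ (by positivity), ← one_div]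
  refine le_trans ?_ h2
  gcongr
  exact norm_pochQ_le_choose ha n

lemma norm_term_le {a b x y : ℂ} {K : ℕ} {r s : ℝ} (ha : ‖a‖ ≤ K + 1) (hb : ‖b‖ ≤ K + 1)
    (hs0 : 0 < s) (hs1 : s < 1) (hx : ‖x‖ ≤ r) (hy : ‖y‖ ≤ r) (m n : ℕ) :
    ‖pochQ a (m + n) * pochQ b m * x ^ m * y ^ n‖ ≤
      (1 - s)⁻¹ ^ (2 * (K + 1)) * ((r / s ^ 2) ^ m * (r / s ^ 2) ^ n) := by
  have hr : 0 ≤ r := (norm_nonneg x).trans hx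
  have h1 := norm_pochQ_le ha hs0 hs1 (m + n)
  have h2 : ‖pochQ b m‖ ≤ (1 - s)⁻¹ ^ (K + 1) * s⁻¹ ^ (m + n) := by
    refine (norm_pochQ_le hb hs0 hs1 m).trans ?_
    have : 0 < 1 - s := by linarith
    gcongr
    · exact (one_le_inv₀ hs0).2 hs1.le
    · omega
  have : 0 < 1 - s := by linarith
  calc ‖pochQ a (m + n) * pochQ b m * x ^ m * y ^ n‖
      = ‖pochQ a (m + n)‖ * ‖pochQ b m‖ * ‖x‖ ^ m * ‖y‖ ^ n := by simp
    _ ≤ ((1 - s)⁻¹ ^ (K + 1) * s⁻¹ ^ (m + n)) * ((1 - s)⁻¹ ^ (K + 1) * s⁻¹ ^ (m + n)) *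
        r ^ m * r ^ n := by gcongr
    _ = _ := by
      simp only [div_pow, inv_pow, ← pow_mul, pow_add]
      field_simp
      ring

lemma summable_geometric_prod {q : ℝ} (hq0 : 0 ≤ q) (hq : q < 1) (M : ℝ) :
    Summable fun p : ℕ × ℕ => M * (q ^ p.1 * q ^ p.2) :=
  ((summable_geometric_of_lt_one hq0 hq).mul_of_nonneg (summable_geometric_of_lt_one hq0 hq)
    (fun _ => by positivity) (fun _ => by positivity)).mul_left M

lemma exists_between_sq {r : ℝ} (hr : r < 1) : ∃ s : ℝ, 0 < s ∧ s < 1 ∧ r / s ^ 2 < 1 := by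
  have h : Tendsto (fun s : ℝ => s ^ 2) (nhdsWithin 1 (Set.Iio 1)) (nhds (1 ^ 2)) :=
    ((continuous_pow 2).tendsto 1).mono_left nhdsWithin_le_nhds
  rw [one_pow] at h
  have h0 : ∀ᶠ s : ℝ in nhdsWithin 1 (Set.Iio 1), 0 < s :=
    nhdsWithin_le_nhds (lt_mem_nhds one_pos)
  have h1 : ∀ᶠ s : ℝ in nhdsWithin 1 (Set.Iio 1), s < 1 := self_mem_nhdsWithin
  obtain ⟨s, hs, hs1, hs0⟩ := ((h.eventually (lt_mem_nhds hr)).and (h1.and h0)).exists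
  exact ⟨s, hs0, hs1, (div_lt_one (by positivity)).2 hs⟩

lemma exists_nat_bound (a b : ℂ) : ∃ K : ℕ, ‖a‖ ≤ K + 1 ∧ ‖b‖ ≤ K + 1 := by
  obtain ⟨K, hK⟩ := exists_nat_ge (max ‖a‖ ‖b‖)
  exact ⟨K, by linarith [le_max_left ‖a‖ ‖b‖], by linarith [le_max_right ‖a‖ ‖b‖]⟩

lemma summable_term (a b : ℂ) {x y : ℂ} (hx : ‖x‖ < 1) (hy : ‖y‖ < 1) :
    Summable fun p : ℕ × ℕ => pochQ a (p.1 + p.2) * pochQ b p.1 * x ^ p.1 * y ^ p.2 := by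
  obtain ⟨K, ha, hb⟩ := exists_nat_bound a b
  obtain ⟨s, hs0, hs1, hs⟩ := exists_between_sq (max_lt hx hy)
  have h0 : 0 ≤ max ‖x‖ ‖y‖ := (norm_nonneg x).trans (le_max_left _ _)
  exact Summable.of_norm_bounded (summable_geometric_prod (by positivity) hs _) fun p =>
    norm_term_le ha hb hs0 hs1 (le_max_left _ _) (le_max_right _ _) p.1 p.2

/-- The convolution `∑_{m ≤ N} (b)ₘ/m! xᵐ y^(N-m)`. -/
noncomputable def convQ (b x y : ℂ) (N : ℕ) : ℂ :=
  ∑ m ∈ Finset.range (N + 1), pochQ b m * x ^ m * y ^ (N - m)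

lemma convQ_zero (b x y : ℂ) : convQ b x y 0 = 1 := by simp [convQ, pochQ_zero]

lemma convQ_succ (b x y : ℂ) (N : ℕ) :
    convQ b x y (N + 1) = y * convQ b x y N + pochQ b (N + 1) * x ^ (N + 1) := by
  rw [convQ, Finset.sum_range_succ, convQ, Finset.mul_sum]
  congr 1
  · refine Finset.sum_congr rfl fun m hm => ?_
    have : m ≤ N := Nat.lt_succ_iff.1 (Finset.mem_range.1 hm)
    rw [Nat.succ_sub this, pow_succ]
    ring
  · simp

lemma sub_mul_convQ (b x y : ℂ) (N : ℕ) :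
    (y - x) * convQ (b + 1) x y N =
      convQ b x y (N + 1) - pochQ (b + 1) (N + 1) * x ^ (N + 1) := by
  induction N with
  | zero =>
    simp only [convQ_succ, convQ_zero, pochQ_succ, pochQ_zero]
    push_cast
    ring
  | succ N ih =>
    rw [convQ_succ b x y (N + 1), convQ_succ (b + 1), pochQ_add_one_succ b (N + 1)]
    linear_combination y * ih

lemma hasSum_convQ (A : ℕ → ℂ) (b x y : ℂ)
    (h : Summable fun p : ℕ × ℕ => A (p.1 + p.2) * pochQ b p.1 * x ^ p.1 * y ^ p.2) :
    HasSum (fun N => A N * convQ b x y N)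
      (∑' p : ℕ × ℕ, A (p.1 + p.2) * pochQ b p.1 * x ^ p.1 * y ^ p.2) := by
  have h1 := (Finset.HasAntidiagonal.sigmaAntidiagonalEquivProd (A := ℕ)).hasSum_iff.2 h.hasSum
  have h2 := h1.sigma fun n => hasSum_fintype _
  convert h2 using 2 with N
  refine Eq.trans ?_ (Finset.sum_coe_sort (Finset.HasAntidiagonal.antidiagonal N)
    (fun p : ℕ × ℕ => A (p.1 + p.2) * pochQ b p.1 * x ^ p.1 * y ^ p.2)).symm
  rw [Finset.Nat.sum_antidiagonal_eq_sum_range_succ_mk, convQ, Finset.mul_sum]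
  refine Finset.sum_congr rfl fun m hm => ?_
  have : m ≤ N := Nat.lt_succ_iff.1 (Finset.mem_range.1 hm)
  simp only [Nat.add_sub_cancel' this]
  ring

/-- The Legendre function `P_ν(1 - 2x) = ₂F₁(-ν, ν + 1; 1; x)`. -/
noncomputable def legL (ν x : ℂ) : ℂ := ∑' n : ℕ, pochQ (-ν) n * pochQ (ν + 1) n * x ^ n

/-- The Appell function `F1(-δ, δ, 1; 1; x, y)`. -/
noncomputable def appF (δ x y : ℂ) : ℂ :=
  ∑' p : ℕ × ℕ, pochQ (-δ) (p.1 + p.2) * pochQ δ p.1 * x ^ p.1 * y ^ p.2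

lemma hasSum_legL (ν : ℂ) {x : ℂ} (hx : ‖x‖ < 1) :
    HasSum (fun n => pochQ (-ν) n * pochQ (ν + 1) n * x ^ n) (legL ν x) := by
  have h := (summable_term (-ν) (ν + 1) hx (y := 0) (by simp)).comp_injective
    (i := fun n : ℕ => (n, 0)) (fun a b h => (Prod.mk.inj h).1)
  simp only [Function.comp_def, add_zero, pow_zero, mul_one] at h
  exact h.hasSum

lemma hasSum_appF (δ : ℂ) {x y : ℂ} (hx : ‖x‖ < 1) (hy : ‖y‖ < 1) :
    HasSum (fun N => pochQ (-δ) N * convQ δ x y N) (appF δ x y) :=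
  hasSum_convQ (pochQ (-δ)) δ x y (summable_term _ _ hx hy)

/-- Prepending a zero to a sequence. -/
def shiftSeq (u : ℕ → ℂ) : ℕ → ℂ
  | 0 => 0
  | n + 1 => u n

lemma HasSum.shiftSeq {u : ℕ → ℂ} {s : ℂ} (h : HasSum u s) : HasSum (shiftSeq u) s := by
  have := (hasSum_nat_add_iff (f := _root_.shiftSeq u) 1 (g := s)).1 h
  simpa [_root_.shiftSeq] using this

lemma pochQ_neg_add_one_succ (δ : ℂ) (M : ℕ) :
    pochQ (-(δ + 1)) (M + 1) = pochQ (-δ) (M + 1) - pochQ (-δ) M := by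
  have h := pochQ_add_one_succ (-(δ + 1)) M
  rw [show -(δ + 1) + 1 = -δ by ring] at h
  linear_combination -h

lemma legendre_coeff_succ (ν : ℂ) (M : ℕ) :
    pochQ (-(ν + 1)) (M + 1) * pochQ (ν + 1 + 1) (M + 1) =
      -(pochQ (-ν) M * pochQ (ν + 1) M * (ν + 1 + M) * (ν + 2 + M) / (M + 1) ^ 2) := by
  have hM : ((M : ℂ) + 1) ≠ 0 := by exact_mod_cast M.succ_ne_zero
  have h1 := add_mul_pochQ (ν + 1) M
  rw [pochQ_succ' (-(ν + 1)), pochQ_succ (ν + 1 + 1), show -(ν + 1) + 1 = -ν by ring]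
  field_simp
  linear_combination pochQ (-ν) M * (ν + 2 + M) * h1

lemma legendre_coeff_add (δ : ℂ) (N : ℕ) :
    2 * (pochQ (-(δ + 1)) N * pochQ (δ + 1) N) =
      pochQ (-δ) N * pochQ (δ + 1) N + pochQ (-(δ + 1)) N * pochQ (δ + 1 + 1) N := by
  cases N with
  | zero => simp only [pochQ_zero]; ring
  | succ M =>
    have hM : ((M : ℂ) + 1) ≠ 0 := by exact_mod_cast M.succ_ne_zero
    rw [legendre_coeff_succ, pochQ_succ' (-(δ + 1)), pochQ_succ (δ + 1), pochQ_succ (-δ),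
      show -(δ + 1) + 1 = -δ by ring]
    field_simp
    ring

lemma legendre_coeff_sub (δ : ℂ) (M : ℕ) :
    2 * (pochQ (-δ) M * pochQ δ (M + 1)) =
      pochQ (-δ) (M + 1) * pochQ (δ + 1) (M + 1) - 2 * (pochQ (-δ) M * pochQ (δ + 1) M) -
        pochQ (-(δ + 1)) (M + 1) * pochQ (δ + 1 + 1) (M + 1) := by
  have hM : ((M : ℂ) + 1) ≠ 0 := by exact_mod_cast M.succ_ne_zero
  rw [legendre_coeff_succ, pochQ_succ' δ, pochQ_succ (δ + 1), pochQ_succ (-δ)]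
  field_simp
  ring

lemma appF_contiguous (δ : ℂ) {x y : ℂ} (hx : ‖x‖ < 1) (hy : ‖y‖ < 1) :
    2 * (y * appF δ x y - y ^ 2 * appF δ x y - (y - x) * appF (δ + 1) x y) =
      x * (legL δ x + legL (δ + 1) x) +
        y * (legL δ x - 2 * x * legL δ x - legL (δ + 1) x) := by
  have hF := hasSum_appF δ hx hy
  have hF' := hasSum_appF (δ + 1) hx hy
  have hL := hasSum_legL δ hx
  have hL' := hasSum_legL (δ + 1) hx
  have h1 := (((hF.mul_left y).sub (hF.shiftSeq.mul_left (y ^ 2))).sub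
    (hF'.mul_left (y - x))).mul_left 2
  have h2 := ((hL.add hL').mul_left x).add
    (((hL.sub (hL.shiftSeq.mul_left (2 * x))).sub hL').mul_left y)
  refine h1.unique ?_
  convert h2 using 2 with N
  cases N with
  | zero =>
    simp only [_root_.shiftSeq, pochQ_zero, convQ_zero]
    ring
  | succ M =>
    simp only [_root_.shiftSeq]
    have e1 := sub_mul_convQ δ x y (M + 1)
    have e2 := convQ_succ δ x y (M + 1)
    have e3 := convQ_succ δ x y M
    have c1 := pochQ_add_one_succ δ (M + 1)
    have c2 := pochQ_neg_add_one_succ δ M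
    have k1 := legendre_coeff_add δ (M + 1)
    have k2 := legendre_coeff_sub δ M
    linear_combination -2 * pochQ (-(δ + 1)) (M + 1) * (e1 + e2 - x ^ (M + 2) * c1) +
      2 * y * pochQ (-δ) M * e3 - 2 * y * convQ δ x y (M + 1) * c2 +
      x ^ (M + 2) * k1 + y * x ^ (M + 1) * k2

lemma legL_recurrence (ν : ℂ) {x : ℂ} (hx : ‖x‖ < 1) :
    (ν + 2) * legL (ν + 2) x = (2 * ν + 3) * (1 - 2 * x) * legL (ν + 1) x
      - (ν + 1) * legL ν x := by
  have h0 := hasSum_legL ν hx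
  have h1 := hasSum_legL (ν + 1) hx
  have h2 := hasSum_legL (ν + 2) hx
  have h3 := ((h1.sub (h1.shiftSeq.mul_left (2 * x))).mul_left (2 * ν + 3)).sub
    (h0.mul_left (ν + 1))
  have h4 := h2.mul_left (ν + 2)
  suffices h : (fun n => (ν + 2) * (pochQ (-(ν + 2)) n * pochQ (ν + 2 + 1) n * x ^ n)) = _ by
    rw [h] at h4
    linear_combination h4.unique h3
  funext N
  cases N with
  | zero =>
    simp only [_root_.shiftSeq, pochQ_zero]
    ring
  | succ M =>
    simp only [_root_.shiftSeq]
    have hM : ((M : ℂ) + 1) ≠ 0 := by exact_mod_cast M.succ_ne_zero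
    have k0 := legendre_coeff_succ (ν + 1) M
    have a1 := add_mul_pochQ (-(ν + 1)) M
    have a2 := add_mul_pochQ (ν + 1) M
    rw [show -(ν + 1) + 1 = -ν by ring] at a1
    rw [show ν + 1 + 1 = ν + 2 by ring] at k0 a2
    rw [show ν + 1 + 1 = ν + 2 by ring]
    have k1 : (ν + 1) * (pochQ (-ν) (M + 1) * pochQ (ν + 1) (M + 1)) =
        -((-(ν + 1) + M) * pochQ (-(ν + 1)) M * (-ν + M) * (ν + 1) * pochQ (ν + 2) M
          / (M + 1) ^ 2) := by
      rw [pochQ_succ (-ν), pochQ_succ' (ν + 1), show ν + 1 + 1 = ν + 2 by ring]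
      field_simp
      linear_combination (ν + 1) * pochQ (ν + 2) M * (-ν + M) * a1
    have k2 : pochQ (-(ν + 1)) (M + 1) * pochQ (ν + 2) (M + 1) =
        pochQ (-(ν + 1)) M * (-(ν + 1) + M) * pochQ (ν + 2) M * (ν + 2 + M) / (M + 1) ^ 2 := by
      rw [pochQ_succ, pochQ_succ]
      field_simp
    linear_combination (norm := (field_simp; ring)) (ν + 2) * x ^ (M + 1) * k0 +
      x ^ (M + 1) * k1 - (2 * ν + 3) * x ^ (M + 1) * k2

lemma poch_two (n : ℕ) : poch 2 n = (n + 1).factorial := by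
  have := poch_natCast_add_one 1 n
  norm_num at this
  exact this

lemma F1A_eq_appF (δ x y : ℂ) : F1A (-δ) δ 1 1 x y = appF δ x y := by
  refine tsum_congr fun p => ?_
  have h1 : (p.1.factorial : ℂ) ≠ 0 := by exact_mod_cast p.1.factorial_ne_zero
  have h2 : (p.2.factorial : ℂ) ≠ 0 := by exact_mod_cast p.2.factorial_ne_zero
  have h3 : ((p.1 + p.2).factorial : ℂ) ≠ 0 := by exact_mod_cast (p.1 + p.2).factorial_ne_zero
  simp only [poch_one, pochQ]
  field_simp

lemma mul_F1A_two (δ x y : ℂ) : δ * F1A (1 - δ) (1 + δ) 1 2 x y =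
    -∑' p : ℕ × ℕ, pochQ (-δ) (p.1 + p.2 + 1) * pochQ (δ + 1) p.1 * x ^ p.1 * y ^ p.2 := by
  rw [F1A, ← tsum_mul_left, ← tsum_neg]
  refine tsum_congr fun p => ?_
  have h1 : (p.1.factorial : ℂ) ≠ 0 := by exact_mod_cast p.1.factorial_ne_zero
  have h2 : (p.2.factorial : ℂ) ≠ 0 := by exact_mod_cast p.2.factorial_ne_zero
  have h3 : ((p.1 + p.2 + 1).factorial : ℂ) ≠ 0 := by
    exact_mod_cast (p.1 + p.2 + 1).factorial_ne_zero
  simp only [poch_one, poch_two, pochQ, poch_succ', show -δ + 1 = 1 - δ by ring,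
    show δ + 1 = 1 + δ by ring]
  field_simp

lemma sub_mul_tsum_convQ (δ : ℂ) {x y : ℂ} (hx : ‖x‖ < 1) (hy : ‖y‖ < 1) :
    (y - x) * ∑' p : ℕ × ℕ,
      pochQ (-δ) (p.1 + p.2 + 1) * pochQ (δ + 1) p.1 * x ^ p.1 * y ^ p.2 =
      appF δ x y - legL δ x := by
  have hs : Summable fun p : ℕ × ℕ =>
      pochQ (-δ) (p.1 + p.2 + 1) * pochQ (δ + 1) p.1 * x ^ p.1 * y ^ p.2 := by
    refine Summable.of_norm_bounded
      ((summable_term (-δ + 1) (δ + 1) hx hy).norm.mul_left ‖-δ‖) fun p => ?_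
    rw [pochQ_succ']
    simp only [norm_mul, norm_inv, mul_assoc, div_eq_mul_inv]
    gcongr ‖-δ‖ * (_ * ?_)
    refine mul_le_of_le_one_left (by positivity) (inv_le_one_of_one_le₀ ?_)
    have := Complex.norm_natCast (p.1 + p.2 + 1)
    push_cast at this ⊢
    rw [this]
    linarith [(Nat.cast_nonneg p.1 : (0 : ℝ) ≤ p.1), (Nat.cast_nonneg p.2 : (0 : ℝ) ≤ p.2)]
  have h1 := (hasSum_convQ (fun N => pochQ (-δ) (N + 1)) (δ + 1) x y hs).mul_left (y - x)
  have h2 := (hasSum_nat_add_iff' 1).2 ((hasSum_appF δ hx hy).sub (hasSum_legL δ hx))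
  simp only [Finset.sum_range_one, pochQ_zero, convQ_zero, pow_zero, mul_one, sub_self,
    sub_zero] at h2
  suffices h : (fun N => (y - x) * (pochQ (-δ) (N + 1) * convQ (δ + 1) x y N)) = _ by
    rw [h] at h1
    exact h1.unique h2
  funext N
  linear_combination pochQ (-δ) (N + 1) * sub_mul_convQ δ x y N

lemma F1A_add_eq (δ : ℂ) {x y : ℂ} (hx : ‖x‖ < 1) (hy : ‖y‖ < 1) :
    F1A (-δ) δ 1 1 x y + δ * (x - y) * F1A (1 - δ) (1 + δ) 1 2 x y =
      2 * appF δ x y - legL δ x := by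
  rw [F1A_eq_appF]
  linear_combination (x - y) * mul_F1A_two δ x y + sub_mul_tsum_convQ δ hx hy

lemma norm_legL_appF_le (δ : ℂ) {r : ℝ} (hr0 : 0 ≤ r) (hr : r < 1) :
    ∃ C A : ℝ, 0 ≤ C ∧ 1 ≤ A ∧ ∀ n : ℕ, ∀ x y : ℂ, ‖x‖ ≤ r → ‖y‖ ≤ r →
      ‖legL (δ + n) x‖ ≤ C * A ^ n ∧ ‖appF (δ + n) x y‖ ≤ C * A ^ n := by
  obtain ⟨K, hK⟩ := exists_nat_ge (‖δ‖)
  obtain ⟨s, hs0, hs1, hs⟩ := exists_between_sq hr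
  set q := r / s ^ 2 with hq
  have hq0 : 0 ≤ q := by positivity
  have hs1' : 0 < 1 - s := by linarith
  have hq1 : 0 < 1 - q := by linarith
  have hA : 1 ≤ (1 - s)⁻¹ := (one_le_inv₀ hs1').2 (by linarith)
  have hn : ∀ n : ℕ, ‖δ + n‖ ≤ (K + n : ℕ) := fun n => by
    refine (norm_add_le _ _).trans ?_
    rw [Complex.norm_natCast]
    push_cast
    linarith
  have hpow : ∀ n : ℕ, (1 - s)⁻¹ ^ (2 * (K + n + 1)) * (1 - q)⁻¹ * (1 - q)⁻¹ =
      ((1 - s)⁻¹ ^ (2 * (K + 1)) * (1 - q)⁻¹ * (1 - q)⁻¹) * ((1 - s)⁻¹ ^ 2) ^ n := fun n => by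
    ring
  have hg := hasSum_geometric_of_lt_one hq0 hs
  refine ⟨(1 - s)⁻¹ ^ (2 * (K + 1)) * (1 - q)⁻¹ * (1 - q)⁻¹, (1 - s)⁻¹ ^ 2, by positivity,
    one_le_pow₀ hA, fun n x y hx hy => ⟨?_, ?_⟩⟩
  · rw [← hpow]
    have h1 : ‖legL (δ + n) x‖ ≤ (1 - s)⁻¹ ^ (2 * (K + n + 1)) * (1 - q)⁻¹ := by
      refine tsum_of_norm_bounded (hg.mul_left _) fun m => ?_
      have := norm_term_le (a := -(δ + n)) (b := δ + n + 1) (K := K + n) (x := x) (y := 0)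
        (by rw [norm_neg]; linarith [hn n])
        ((norm_add_le _ _).trans (by rw [norm_one]; linarith [hn n])) hs0 hs1 hx
        (by simpa using hr0) m 0
      simpa using this
    refine h1.trans (le_mul_of_one_le_right (by positivity) ((one_le_inv₀ hq1).2 (by linarith)))
  · rw [← hpow]
    have hg2 := hg.mul hg (hg.summable.mul_of_nonneg hg.summable
      (fun _ => by positivity) (fun _ => by positivity))
    rw [mul_assoc ((1 - s)⁻¹ ^ (2 * (K + n + 1)))]
    refine tsum_of_norm_bounded (hg2.mul_left _) fun p => ?_
    exact norm_term_le (by rw [norm_neg]; linarith [hn n]) (by linarith [hn n]) hs0 hs1 hx hy _ _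

lemma norm_le_of_approx_recurrence {p : ℕ → ℂ} {a b : ℂ} (hab : a * b = 1) (ha : ‖a‖ = 1)
    (hb : ‖b‖ = 1) (hne : a ≠ b) {η ρ : ℝ} (hη : 0 ≤ η)
    (hρ : 1 + 2 * η * (1 + 2 / ‖a - b‖) ≤ ρ) {n₀ : ℕ}
    (h : ∀ n, n₀ ≤ n → ‖p (n + 2) - (a + b) * p (n + 1) + p n‖ ≤ η * (‖p (n + 1)‖ + ‖p n‖)) :
    ∀ n, n₀ ≤ n → ‖p n‖ ≤ 2 / ‖a - b‖ * (‖p (n₀ + 1)‖ + ‖p n₀‖) * ρ ^ n := by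
  set κ := ‖a - b‖ with hκ
  have hκ0 : 0 < κ := norm_pos_iff.2 (sub_ne_zero.2 hne)
  have hρ1 : 1 ≤ ρ := le_trans (le_add_of_nonneg_right (by positivity)) hρ
  set S : ℕ → ℝ := fun n => ‖p (n + 1) - a * p n‖ + ‖p (n + 1) - b * p n‖ with hS
  have hp0 : ∀ n, ‖p n‖ ≤ S n / κ := fun n => by
    rw [le_div_iff₀ hκ0, hκ, ← norm_mul,
      show p n * (a - b) = (p (n + 1) - b * p n) - (p (n + 1) - a * p n) by ring]
    exact (norm_sub_le _ _).trans (by simp only [hS]; linarith)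
  have hp1 : ∀ n, ‖p (n + 1)‖ ≤ S n + S n / κ := fun n => by
    have h1 : ‖p (n + 1)‖ ≤ ‖p (n + 1) - a * p n‖ + ‖a * p n‖ := by
      simpa using norm_add_le (p (n + 1) - a * p n) (a * p n)
    rw [norm_mul, ha, one_mul] at h1
    have h2 : ‖p (n + 1) - a * p n‖ ≤ S n := le_add_of_nonneg_right (norm_nonneg _)
    linarith [hp0 n]
  have hstep : ∀ n, n₀ ≤ n → S (n + 1) ≤ ρ * S n := fun n hn => by
    set e := p (n + 2) - (a + b) * p (n + 1) + p n with he
    have h1 : ‖p (n + 2) - a * p (n + 1)‖ ≤ ‖p (n + 1) - a * p n‖ + ‖e‖ := by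
      rw [show p (n + 2) - a * p (n + 1) = b * (p (n + 1) - a * p n) + e by
        rw [he]; linear_combination p n * hab]
      refine (norm_add_le _ _).trans ?_
      rw [norm_mul, hb, one_mul]
    have h2 : ‖p (n + 2) - b * p (n + 1)‖ ≤ ‖p (n + 1) - b * p n‖ + ‖e‖ := by
      rw [show p (n + 2) - b * p (n + 1) = a * (p (n + 1) - b * p n) + e by
        rw [he]; linear_combination p n * hab]
      refine (norm_add_le _ _).trans ?_
      rw [norm_mul, ha, one_mul]
    have h3 : ‖e‖ ≤ η * (S n * (1 + 2 / κ)) := by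
      refine (h n hn).trans (mul_le_mul_of_nonneg_left ?_ hη)
      have := add_le_add (hp1 n) (hp0 n)
      refine this.trans (le_of_eq ?_)
      ring
    have hS0 : 0 ≤ S n := by positivity
    have h4 := mul_le_mul_of_nonneg_right hρ hS0
    calc S (n + 1) ≤ S n + 2 * ‖e‖ := by simp only [hS]; linarith
      _ ≤ S n + 2 * (η * (S n * (1 + 2 / κ))) := by linarith
      _ = (1 + 2 * η * (1 + 2 / κ)) * S n := by ring
      _ ≤ ρ * S n := h4
  have hS00 : 0 ≤ S n₀ := by positivity
  have hgrow : ∀ n, n₀ ≤ n → S n ≤ S n₀ * ρ ^ n := fun n hn => by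
    induction n, hn using Nat.le_induction with
    | base => exact le_mul_of_one_le_right hS00 (one_le_pow₀ hρ1)
    | succ n hn ih =>
      refine (hstep n hn).trans ?_
      rw [pow_succ]
      nlinarith
  have hS0 : S n₀ ≤ 2 * (‖p (n₀ + 1)‖ + ‖p n₀‖) := by
    have h1 := norm_sub_le (p (n₀ + 1)) (a * p n₀)
    have h2 := norm_sub_le (p (n₀ + 1)) (b * p n₀)
    rw [norm_mul, ha, one_mul] at h1
    rw [norm_mul, hb, one_mul] at h2
    simp only [hS]
    linarith
  intro n hn
  refine (hp0 n).trans ?_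
  rw [div_le_iff₀ hκ0]
  refine (hgrow n hn).trans ?_
  have : 2 / κ * (‖p (n₀ + 1)‖ + ‖p n₀‖) * ρ ^ n * κ = 2 * (‖p (n₀ + 1)‖ + ‖p n₀‖) * ρ ^ n := by
    field_simp
  rw [this]
  gcongr

lemma exists_unit_roots {c : ℝ} (hc0 : 0 < c) (hc1 : c < 1) :
    ∃ a b : ℂ, a * b = 1 ∧ ‖a‖ = 1 ∧ ‖b‖ = 1 ∧ a ≠ b ∧ a + b = 2 * (1 - 2 * (c : ℂ)) := by
  set s := Real.sqrt (1 - (1 - 2 * c) ^ 2) with hs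
  have hpos : 0 < 1 - (1 - 2 * c) ^ 2 := by nlinarith
  have hs0 : 0 < s := Real.sqrt_pos.2 hpos
  have hsq : s ^ 2 = 1 - (1 - 2 * c) ^ 2 := Real.sq_sqrt hpos.le
  have hsq' : (s : ℂ) ^ 2 = 1 - (1 - 2 * (c : ℂ)) ^ 2 := by exact_mod_cast hsq
  have hn : ∀ t : ℝ, t ^ 2 = s ^ 2 → ‖(⟨1 - 2 * c, t⟩ : ℂ)‖ = 1 := fun t ht => by
    rw [Complex.norm_def, Complex.normSq_mk, Real.sqrt_eq_one]
    linarith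
  refine ⟨⟨1 - 2 * c, s⟩, ⟨1 - 2 * c, -s⟩, ?_, hn _ rfl, hn _ (by ring), ?_, ?_⟩
  · apply Complex.ext <;> simp
    · linarith
    · ring
  · intro h
    have := congrArg Complex.im h
    simp only at this
    linarith
  · apply Complex.ext <;> simp
    ring

lemma exists_legL_bound (δ : ℂ) {c : ℝ} (hc0 : 0 < c) (hc1 : c < 1) {ρ : ℝ} (hρ : 1 < ρ) :
    ∃ ε > 0, ∃ C : ℝ, ∀ w ∈ Metric.ball (c : ℂ) ε,
      ‖w‖ < 1 ∧ ∀ n : ℕ, ‖legL (δ + n) w‖ ≤ C * ρ ^ n := by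
  obtain ⟨a, b, hab, ha, hb, hne, hsum⟩ := exists_unit_roots hc0 hc1
  have hκ : 0 < ‖a - b‖ := norm_pos_iff.2 (sub_ne_zero.2 hne)
  set η := (ρ - 1) / (2 * (1 + 2 / ‖a - b‖)) with hη
  have hη0 : 0 < η := div_pos (by linarith) (by positivity)
  have hηρ : 1 + 2 * η * (1 + 2 / ‖a - b‖) ≤ ρ := by
    rw [hη]
    field_simp
    linarith
  obtain ⟨C, A, hC, hA, hCA⟩ := norm_legL_appF_le δ (r := (1 + c) / 2) (by linarith) (by linarith)
  obtain ⟨n₀, hn₀⟩ := exists_nat_ge (6 / η + ‖δ‖)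
  have hε : 0 < min (η / 8) ((1 - c) / 2) := lt_min (by linarith) (by linarith)
  refine ⟨_, hε, 2 / ‖a - b‖ * (C * A ^ (n₀ + 1) + C * A ^ n₀) + C * A ^ n₀, fun w hw => ?_⟩
  rw [Metric.mem_ball, dist_eq_norm, lt_min_iff] at hw
  have hwr : ‖w‖ ≤ (1 + c) / 2 := by
    have := norm_add_le (w - c) (c : ℂ)
    rw [sub_add_cancel, Complex.norm_real, Real.norm_of_nonneg hc0.le] at this
    linarith [hw.2]
  have hw1 : ‖w‖ < 1 := by linarith
  refine ⟨hw1, fun n => ?_⟩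
  have hρn : (1 : ℝ) ≤ ρ ^ n := one_le_pow₀ hρ.le
  have hlow : ∀ n : ℕ, ‖legL (δ + n) w‖ ≤ C * A ^ n := fun n => (hCA n w w hwr hwr).1
  rcases lt_or_ge n n₀ with hn | hn
  · have h1 : ‖legL (δ + n) w‖ ≤ C * A ^ n₀ :=
      (hlow n).trans (mul_le_mul_of_nonneg_left (pow_le_pow_right₀ hA hn.le) hC)
    refine h1.trans ((le_add_of_nonneg_left (by positivity)).trans
      (le_mul_of_one_le_right (by positivity) hρn))
  · have key := norm_le_of_approx_recurrence (p := fun n => legL (δ + n) w) hab ha hb hne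
      hη0.le hηρ (n₀ := n₀) (fun m hm => ?_) n hn
    · refine key.trans (mul_le_mul_of_nonneg_right ?_ (by positivity))
      refine (mul_le_mul_of_nonneg_left (add_le_add (hlow _) (hlow _)) (by positivity)).trans ?_
      exact le_add_of_nonneg_right (by positivity)
    · have hrec := legL_recurrence (δ + m) hw1
      rw [show δ + m + 2 = δ + (m + 2 : ℕ) by push_cast; ring,
        show δ + m + 1 = δ + (m + 1 : ℕ) by push_cast; ring] at hrec
      set p := fun n : ℕ => legL (δ + n) w
      change (δ + (m + 2 : ℕ)) * p (m + 2) = _ * p (m + 1) - _ * p m at hrec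
      change ‖p (m + 2) - (a + b) * p (m + 1) + p m‖ ≤ η * (‖p (m + 1)‖ + ‖p m‖)
      set v := δ + (m + 2 : ℕ) with hv
      have hvn : 6 / η ≤ ‖v‖ := by
        have h1 := norm_sub_norm_le ((m + 2 : ℕ) : ℂ) (-δ)
        rw [norm_neg, Complex.norm_natCast, sub_neg_eq_add, add_comm _ δ] at h1
        have h2 : (n₀ : ℝ) ≤ (m + 2 : ℕ) := by exact_mod_cast hm.trans (by omega)
        linarith
      have hv0 : 0 < ‖v‖ := lt_of_lt_of_le (by positivity) hvn
      have hv6 : 6 / ‖v‖ ≤ η := by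
        rw [div_le_iff₀ hη0] at hvn
        rw [div_le_iff₀ hv0]
        linarith
      have hvne : v ≠ 0 := norm_pos_iff.1 hv0
      have heq : p (m + 2) - (a + b) * p (m + 1) + p m =
          (4 * (c - w) - (1 - 2 * w) / v) * p (m + 1) + 1 / v * p m := by
        rw [hsum]
        field_simp
        push_cast at hrec hv ⊢
        have hv' : v = δ + m + 2 := by rw [hv]; ring
        rw [hv'] at hrec ⊢
        linear_combination hrec
      rw [heq]
      have h12 : ‖1 - 2 * w‖ ≤ 3 := by
        refine (norm_sub_le _ _).trans ?_
        simp only [norm_one, norm_mul, Complex.norm_ofNat]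
        linarith
      have hc1 : ‖4 * (c - w) - (1 - 2 * w) / v‖ ≤ η := by
        refine (norm_sub_le _ _).trans ?_
        rw [norm_mul, norm_div, norm_sub_rev, Complex.norm_ofNat]
        have h4 : ‖1 - 2 * w‖ / ‖v‖ ≤ 3 / ‖v‖ := by gcongr
        have h5 : 6 / ‖v‖ = 2 * (3 / ‖v‖) := by ring
        linarith [hw.1]
      have hc2 : ‖1 / v‖ ≤ η := by
        rw [norm_div, norm_one]
        have h4 : 1 / ‖v‖ ≤ 6 / ‖v‖ := by gcongr; norm_num
        linarith
      refine (norm_add_le _ _).trans ?_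
      rw [norm_mul, norm_mul, mul_add]
      gcongr

lemma appF_step (δ : ℂ) {x y h : ℂ} (hx : ‖x‖ < 1) (hy : ‖y‖ < 1) (hy0 : y ≠ 0)
    (hh : h * (y * (1 - y)) = y - x) :
    2 * appF δ x y - legL δ x = (1 - h * (1 - 2 * y)) * legL δ x +
      h * (2 * appF (δ + 1) x y - legL (δ + 1) x) := by
  have hy1 : 1 - y ≠ 0 := by
    intro h0
    rw [← sub_eq_zero.1 h0, norm_one] at hy
    exact lt_irrefl _ hy
  have hc := appF_contiguous δ hx hy
  refine mul_left_cancel₀ (mul_ne_zero hy0 hy1) ?_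
  linear_combination hc + (-2 * appF (δ + 1) x y + legL (δ + 1) x
    + (1 - 2 * y) * legL δ x) * hh

lemma appF_iterate (δ : ℂ) {x y h : ℂ} (hx : ‖x‖ < 1) (hy : ‖y‖ < 1) (hy0 : y ≠ 0)
    (hh : h * (y * (1 - y)) = y - x) (N : ℕ) :
    2 * appF δ x y - legL δ x =
      (1 - h * (1 - 2 * y)) * ∑ l ∈ Finset.range N, h ^ l * legL (δ + l) x +
      h ^ N * (2 * appF (δ + N) x y - legL (δ + N) x) := by
  induction N with
  | zero => simp
  | succ N ih =>
    rw [ih, Finset.sum_range_succ, appF_step (δ + N) hx hy hy0 hh]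
    push_cast
    rw [← add_assoc]
    ring

lemma eventually_generating (δ : ℂ) {x : ℂ} (hx : ‖x‖ < 1) (hx0 : x ≠ 0) :
    ∀ᶠ y in nhds x, 2 * appF δ x y - legL δ x =
      (1 - (y - x) / (y * (1 - y)) * (1 - 2 * y)) *
        ∑' l : ℕ, ((y - x) / (y * (1 - y))) ^ l * legL (δ + l) x := by
  have hx1 : 1 - x ≠ 0 := by
    intro h0
    rw [← sub_eq_zero.1 h0, norm_one] at hx
    exact lt_irrefl _ hx
  obtain ⟨C, A, hC, hA, hCA⟩ := norm_legL_appF_le δ (r := (1 + ‖x‖) / 2) (by positivity)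
    (by linarith)
  have hcont : ContinuousAt (fun y : ℂ => ‖(y - x) / (y * (1 - y))‖ * A) x := by
    have : x * (1 - x) ≠ 0 := mul_ne_zero hx0 hx1
    fun_prop (disch := assumption)
  have hev : ∀ᶠ y in nhds x, ‖(y - x) / (y * (1 - y))‖ * A < 1 :=
    hcont.eventually (gt_mem_nhds (by simp))
  have hev2 : ∀ᶠ y in nhds x, ‖y‖ < (1 + ‖x‖) / 2 :=
    continuous_norm.continuousAt.eventually (gt_mem_nhds (by linarith))
  filter_upwards [hev, hev2, isOpen_ne.mem_nhds hx0] with y h1 h2 hy0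
  have hy : ‖y‖ < 1 := by linarith
  have hy1 : 1 - y ≠ 0 := by
    intro h0
    rw [← sub_eq_zero.1 h0, norm_one] at hy
    exact lt_irrefl _ hy
  set h := (y - x) / (y * (1 - y)) with hh
  have hh' : h * (y * (1 - y)) = y - x := div_mul_cancel₀ _ (mul_ne_zero hy0 hy1)
  have hgeo : Summable fun n : ℕ => C * (‖h‖ * A) ^ n :=
    (summable_geometric_of_lt_one (by positivity) h1).mul_left C
  have hb : ∀ n : ℕ, ‖h ^ n * legL (δ + n) x‖ ≤ C * (‖h‖ * A) ^ n := fun n => by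
    rw [norm_mul, norm_pow, mul_pow]
    have := mul_le_mul_of_nonneg_left (hCA n x y (by linarith) h2.le).1
      (pow_nonneg (norm_nonneg h) n)
    linarith
  have hb' : ∀ n : ℕ, ‖h ^ n * appF (δ + n) x y‖ ≤ C * (‖h‖ * A) ^ n := fun n => by
    rw [norm_mul, norm_pow, mul_pow]
    have := mul_le_mul_of_nonneg_left (hCA n x y (by linarith) h2.le).2
      (pow_nonneg (norm_nonneg h) n)
    linarith
  have hs : Summable fun n : ℕ => h ^ n * legL (δ + n) x := Summable.of_norm_bounded hgeo hb
  have hs' : Summable fun n : ℕ => h ^ n * appF (δ + n) x y := Summable.of_norm_bounded hgeo hb'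
  have ht := (hs.hasSum.tendsto_sum_nat.const_mul (1 - h * (1 - 2 * y))).add
    ((hs'.tendsto_atTop_zero.const_mul 2).sub hs.tendsto_atTop_zero)
  simp only [mul_zero, sub_zero, add_zero] at ht
  refine tendsto_nhds_unique (tendsto_const_nhds.congr fun N => ?_) ht
  rw [appF_iterate δ hx hy hy0 hh' N]
  ring

lemma differentiableOn_appF (δ : ℂ) {x : ℂ} (hx : ‖x‖ < 1) :
    DifferentiableOn ℂ (fun y => appF δ x y) (Metric.ball 0 1) := by
  intro y₀ hy₀
  rw [mem_ball_zero_iff] at hy₀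
  have hr1 : max ‖x‖ ((1 + ‖y₀‖) / 2) < 1 := max_lt hx (by linarith)
  obtain ⟨s, hs0, hs1, hq⟩ := exists_between_sq hr1
  obtain ⟨K, ha, hb⟩ := exists_nat_bound (-δ) δ
  have hq0 : 0 ≤ max ‖x‖ ((1 + ‖y₀‖) / 2) / s ^ 2 :=
    div_nonneg ((norm_nonneg x).trans (le_max_left _ _)) (by positivity)
  have hd : DifferentiableOn ℂ (fun y => appF δ x y)
      (Metric.ball 0 (max ‖x‖ ((1 + ‖y₀‖) / 2))) := by
    refine Complex.differentiableOn_tsum_of_summable_norm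
      (summable_geometric_prod hq0 hq ((1 - s)⁻¹ ^ (2 * (K + 1)))) (fun p => by fun_prop)
      Metric.isOpen_ball (fun p y hy => ?_)
    exact norm_term_le ha hb hs0 hs1 (le_max_left _ _) (mem_ball_zero_iff.1 hy).le p.1 p.2
  refine (hd.differentiableAt (Metric.isOpen_ball.mem_nhds ?_)).differentiableWithinAt
  rw [mem_ball_zero_iff]
  exact lt_of_lt_of_le (by linarith) (le_max_right _ _)

lemma differentiableOn_tsum_pow_mul {u : ℕ → ℂ}
    (hu : ∀ ρ : ℝ, 1 < ρ → ∃ C : ℝ, ∀ n, ‖u n‖ ≤ C * ρ ^ n) :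
    DifferentiableOn ℂ (fun h => ∑' n, h ^ n * u n) (Metric.ball 0 1) := by
  intro h₀ hh₀
  rw [mem_ball_zero_iff] at hh₀
  set r := (1 + ‖h₀‖) / 2 with hr
  have hr0 : 0 < r := by positivity
  have hr1 : r < 1 := by linarith
  obtain ⟨ρ, hρ1, hρr⟩ := exists_between (one_lt_inv_iff₀.2 ⟨hr0, hr1⟩)
  obtain ⟨C, hC⟩ := hu ρ hρ1
  have hρ0 : 0 < ρ := by linarith
  have hq : r * ρ < 1 := by
    calc r * ρ < r * r⁻¹ := by gcongr
      _ = 1 := mul_inv_cancel₀ hr0.ne'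
  have hd : DifferentiableOn ℂ (fun h => ∑' n, h ^ n * u n) (Metric.ball 0 r) := by
    refine Complex.differentiableOn_tsum_of_summable_norm
      ((summable_geometric_of_lt_one (by positivity) hq).mul_left C) (fun p => by fun_prop)
      Metric.isOpen_ball (fun n h hh => ?_)
    rw [mem_ball_zero_iff] at hh
    rw [norm_mul, norm_pow, mul_pow, mul_left_comm]
    exact mul_le_mul (pow_le_pow_left₀ (norm_nonneg _) hh.le n) (hC n) (norm_nonneg _)
      (by positivity)
  refine (hd.differentiableAt (Metric.isOpen_ball.mem_nhds ?_)).differentiableWithinAt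
  rw [mem_ball_zero_iff]
  linarith

lemma generating (δ : ℂ) {c y : ℝ} (hc0 : 0 < c) (hc1 : c < 1) (hcy : c ≤ y) (hy : y ^ 2 < c) :
    2 * appF δ c y - legL δ c =
      (1 - ((y : ℂ) - c) / (y * (1 - y)) * (1 - 2 * y)) *
        ∑' l : ℕ, (((y : ℂ) - c) / (y * (1 - y))) ^ l * legL (δ + l) c := by
  have hcn : ‖(c : ℂ)‖ < 1 := by rwa [Complex.norm_real, Real.norm_of_nonneg hc0.le]
  have hS : ∀ t : ℝ, t ∈ Set.Ico c (Real.sqrt c) → 0 < t ∧ t < 1 ∧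
      0 ≤ (t - c) / (t * (1 - t)) ∧ (t - c) / (t * (1 - t)) < 1 := by
    rintro t ⟨h1, h2⟩
    have ht0 : 0 < t := by linarith
    have ht2 : t ^ 2 < c := (Real.lt_sqrt ht0.le).1 h2
    have ht1 : t < 1 := by nlinarith
    have hp : 0 < t * (1 - t) := mul_pos ht0 (by linarith)
    refine ⟨ht0, ht1, div_nonneg (by linarith) hp.le, (div_lt_one hp).2 (by nlinarith)⟩
  have hpre : IsPreconnected (Complex.ofReal '' Set.Ico c (Real.sqrt c)) :=
    isPreconnected_Ico.image _ Complex.continuous_ofReal.continuousOn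
  have hu : ∀ ρ : ℝ, 1 < ρ → ∃ C : ℝ, ∀ n : ℕ, ‖legL (δ + n) c‖ ≤ C * ρ ^ n := fun ρ hρ => by
    obtain ⟨ε, hε, C, hC⟩ := exists_legL_bound δ hc0 hc1 hρ
    exact ⟨C, (hC c (Metric.mem_ball_self hε)).2⟩
  have hmem : ∀ w ∈ Complex.ofReal '' Set.Ico c (Real.sqrt c),
      w ∈ Metric.ball (0 : ℂ) 1 ∧ w * (1 - w) ≠ 0 ∧
        (w - c) / (w * (1 - w)) ∈ Metric.ball (0 : ℂ) 1 := by
    rintro _ ⟨t, ht, rfl⟩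
    obtain ⟨h1, h2, h3, h4⟩ := hS t ht
    refine ⟨?_, ?_, ?_⟩
    · rwa [mem_ball_zero_iff, Complex.norm_real, Real.norm_of_nonneg h1.le]
    · exact_mod_cast (mul_pos h1 (sub_pos.2 h2)).ne'
    · rw [mem_ball_zero_iff]
      rw [show ((t : ℂ) - c) / (t * (1 - t)) = (((t - c) / (t * (1 - t)) : ℝ) : ℂ) by
        push_cast; rfl, Complex.norm_real, Real.norm_of_nonneg h3]
      exact h4
  have hcS : (c : ℂ) ∈ Complex.ofReal '' Set.Ico c (Real.sqrt c) :=
    ⟨c, ⟨le_rfl, (Real.lt_sqrt hc0.le).2 (by nlinarith)⟩, rfl⟩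
  have hyS : (y : ℂ) ∈ Complex.ofReal '' Set.Ico c (Real.sqrt c) :=
    ⟨y, ⟨hcy, (Real.lt_sqrt (by linarith)).2 hy⟩, rfl⟩
  refine AnalyticOnNhd.eqOn_of_preconnected_of_eventuallyEq (𝕜 := ℂ)
    (f := fun y => 2 * appF δ c y - legL δ c)
    (g := fun y => (1 - (y - c) / (y * (1 - y)) * (1 - 2 * y)) *
        ∑' l : ℕ, ((y - c) / (y * (1 - y))) ^ l * legL (δ + l) c)
    (fun w hw => ?_) (fun w hw => ?_) hpre hcS
    (eventually_generating δ hcn (by exact_mod_cast hc0.ne')) hyS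
  · have := (differentiableOn_appF δ hcn).analyticAt (Metric.isOpen_ball.mem_nhds (hmem w hw).1)
    fun_prop
  · obtain ⟨-, h2, h3⟩ := hmem w hw
    have h4 := (differentiableOn_tsum_pow_mul hu).analyticAt (Metric.isOpen_ball.mem_nhds h3)
    have h5 : AnalyticAt ℂ (fun y : ℂ => (y - c) / (y * (1 - y))) w := by
      fun_prop (disch := assumption)
    have h6 := AnalyticAt.fun_comp (f := fun y : ℂ => (y - c) / (y * (1 - y))) h4 h5
    exact (analyticAt_const.sub (h5.mul (by fun_prop))).mul h6

lemma differentiableOn_iteratedDeriv {f : ℂ → ℂ} {U : Set ℂ} (hU : IsOpen U)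
    (hf : DifferentiableOn ℂ f U) (j : ℕ) : DifferentiableOn ℂ (iteratedDeriv j f) U := by
  induction j with
  | zero => simpa using hf
  | succ j ih => rw [iteratedDeriv_succ]; exact ih.deriv hU

lemma TendstoLocallyUniformlyOn.iteratedDeriv {F : ℕ → ℂ → ℂ} {f : ℂ → ℂ} {U : Set ℂ}
    (h : TendstoLocallyUniformlyOn F f atTop U) (hU : IsOpen U)
    (hF : ∀ n, DifferentiableOn ℂ (F n) U) (j : ℕ) :
    TendstoLocallyUniformlyOn (fun n => iteratedDeriv j (F n)) (iteratedDeriv j f) atTop U := by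
  induction j with
  | zero => simpa using h
  | succ j ih =>
    simp only [iteratedDeriv_succ]
    exact ih.deriv (Eventually.of_forall fun n => differentiableOn_iteratedDeriv hU (hF n) j) hU

lemma tendsto_sum_iteratedDeriv {f : ℕ → ℂ → ℂ} {U : Set ℂ} (hU : IsOpen U) {b : ℕ → ℝ}
    (hb : Summable b) (hf : ∀ n, DifferentiableOn ℂ (f n) U) (hfb : ∀ n, ∀ w ∈ U, ‖f n w‖ ≤ b n)
    {z : ℂ} (hz : z ∈ U) (j : ℕ) :
    Tendsto (fun N => ∑ n ∈ Finset.range N, iteratedDeriv j (f n) z) atTop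
      (nhds (iteratedDeriv j (fun w => ∑' n, f n w) z)) := by
  have h := ((tendstoUniformlyOn_tsum_nat hb hfb).tendstoLocallyUniformlyOn.iteratedDeriv hU
    (fun n => DifferentiableOn.fun_sum fun i _ => hf i) j).tendsto_at hz
  refine h.congr fun N => iteratedDeriv_fun_sum fun i _ => ?_
  exact ((hf i).analyticAt (hU.mem_nhds hz)).contDiffAt

lemma iteratedDeriv_ofReal {g : ℂ → ℂ} {U : Set ℂ} (hU : IsOpen U) (hg : DifferentiableOn ℂ g U)
    (j : ℕ) : ∀ t : ℝ, (t : ℂ) ∈ U →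
      iteratedDeriv j (fun s : ℝ => g s) t = iteratedDeriv j g (t : ℂ) := by
  induction j with
  | zero => simp
  | succ j ih =>
    intro t ht
    rw [iteratedDeriv_succ, iteratedDeriv_succ]
    have hev : iteratedDeriv j (fun s : ℝ => g s) =ᶠ[nhds t] fun s => iteratedDeriv j g (s : ℂ) :=
      eventually_of_mem ((hU.preimage Complex.continuous_ofReal).mem_nhds ht) ih
    rw [hev.deriv_eq]
    exact (((differentiableOn_iteratedDeriv hU hg j).differentiableAt
      (hU.mem_nhds ht)).hasDerivAt.comp_ofReal).deriv

lemma iteratedDeriv_mul_half_pow (j n : ℕ) (a z : ℂ) :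
    iteratedDeriv j (fun w : ℂ => a * ((1 - w) / 2) ^ n) z =
      a * ((-1 / 2) ^ n * (n.descFactorial j * (z - 1) ^ (n - j))) := by
  have h : (fun w : ℂ => a * ((1 - w) / 2) ^ n) =
      fun w => (a * (-1 / 2) ^ n) * (w - 1) ^ n := by
    funext w
    rw [mul_assoc, ← mul_pow]
    ring
  rw [h, iteratedDeriv_const_mul_field, iteratedDeriv_comp_sub_const j (fun w => w ^ n) 1]
  simp only [iteratedDeriv_pow]
  ring

lemma poch_add (a : ℂ) (m n : ℕ) : poch a (m + n) = poch a m * poch (a + m) n := by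
  rw [poch, Finset.prod_range_add]
  simp [poch, add_assoc]

lemma poch_neg_sub (a : ℂ) (k : ℕ) : poch (-(a + k)) k = (-1) ^ k * poch (a + 1) k := by
  induction k generalizing a with
  | zero => simp [poch]
  | succ k ih =>
    rw [poch_succ', poch_succ, show -(a + (k + 1 : ℕ)) + 1 = -(a + k) by push_cast; ring, ih]
    push_cast
    ring

lemma Gamma_add_natCast {a : ℂ} (ha : ∀ m : ℕ, a + m ≠ 0) (n : ℕ) :
    Complex.Gamma (a + n) = poch a n * Complex.Gamma a := by
  induction n with
  | zero => simp [poch]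
  | succ n ih =>
    rw [poch_succ, show a + (n + 1 : ℕ) = a + n + 1 by push_cast; ring,
      Complex.Gamma_add_one _ (ha n), ih]
    ring

lemma summable_F21_natCast_add_one (a b : ℂ) (k : ℕ) {x : ℂ} (hx : ‖x‖ < 1) :
    Summable fun n : ℕ => poch a n * poch b n / (poch ((k : ℂ) + 1) n * n.factorial) * x ^ n := by
  have h := (summable_term a b hx (y := 0) (by simp)).comp_injective
    (i := fun n : ℕ => (n, 0)) (fun a b h => (Prod.mk.inj h).1)
  simp only [Function.comp_def, add_zero, pow_zero, mul_one] at h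
  refine Summable.of_norm_bounded h.norm fun n => ?_
  have hk : (k.factorial : ℂ) ≠ 0 := by exact_mod_cast k.factorial_ne_zero
  have hn : (n.factorial : ℂ) ≠ 0 := by exact_mod_cast n.factorial_ne_zero
  have hnk : ((n + k).factorial : ℂ) ≠ 0 := by exact_mod_cast (n + k).factorial_ne_zero
  have hp := poch_natCast_add_one k n
  have hp0 : poch ((k : ℂ) + 1) n ≠ 0 := fun h0 => hnk (by rw [← hp, h0, zero_mul])
  have heq : poch a n * poch b n / (poch ((k : ℂ) + 1) n * n.factorial) * x ^ n =
      pochQ a n * pochQ b n * x ^ n * ((n.factorial * k.factorial : ℕ) / (n + k).factorial) := by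
    simp only [pochQ, ← hp]
    push_cast
    field_simp
  rw [heq, norm_mul]
  refine mul_le_of_le_one_right (norm_nonneg _) ?_
  rw [norm_div, Complex.norm_natCast, Complex.norm_natCast]
  refine div_le_one_of_le₀ ?_ (by positivity)
  exact_mod_cast Nat.le_of_dvd (Nat.factorial_pos _)
    (Nat.factorial_mul_factorial_dvd_factorial_add n k)

lemma Gamma_div_mul_poch_eq (k n : ℕ) {μ : ℂ} (hμ : ∀ m : ℕ, μ + 1 + m ≠ 0) (z : ℂ) :
    Complex.Gamma (μ + (2 * k + 3 : ℕ) - 2) /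
        (Complex.Gamma (μ + 1) * Complex.Gamma (((2 * k + 3 : ℕ) : ℂ) - 1)) *
      (poch (-μ) n * poch (μ + (2 * k + 3 : ℕ) - 2) n / (poch ((k : ℂ) + 1) n * n.factorial) *
        ((1 - z) / 2) ^ n) =
    1 / ((2 * k + 1).doubleFactorial : ℂ) *
      (pochQ (-(μ + k)) (k + n) * pochQ (μ + k + 1) (k + n) *
        ((-1 / 2) ^ (k + n) * ((k + n).descFactorial k * (z - 1) ^ (k + n - k)))) := by
  have hk : (k.factorial : ℂ) ≠ 0 := by exact_mod_cast k.factorial_ne_zero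
  have hn : (n.factorial : ℂ) ≠ 0 := by exact_mod_cast n.factorial_ne_zero
  have hd : ((2 * k + 1).doubleFactorial : ℂ) ≠ 0 := by
    exact_mod_cast (Nat.doubleFactorial_pos _).ne'
  have hG : Complex.Gamma (μ + 1) ≠ 0 :=
    Complex.Gamma_ne_zero fun m h0 => hμ m (by rw [h0]; ring)
  have hA : poch (-(μ + k)) (k + n) = (-1) ^ k * poch (μ + 1) k * poch (-μ) n := by
    rw [poch_add, poch_neg_sub, show -(μ + k) + k = -μ by ring]
  have hB : poch (μ + k + 1) (k + n) = poch (μ + k + 1) k * poch (μ + 2 * k + 1) n := by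
    rw [poch_add, show μ + k + 1 + k = μ + 2 * k + 1 by ring]
  have hG1 : Complex.Gamma (μ + (2 * k + 3 : ℕ) - 2) =
      poch (μ + 1) k * poch (μ + k + 1) k * Complex.Gamma (μ + 1) := by
    rw [show μ + (2 * k + 3 : ℕ) - 2 = μ + 1 + (k + k : ℕ) by push_cast; ring,
      Gamma_add_natCast hμ, poch_add, show μ + 1 + (k : ℂ) = μ + k + 1 by ring]
  have hG2 : Complex.Gamma (((2 * k + 3 : ℕ) : ℂ) - 1) =
      (2 * k + 1).doubleFactorial * (2 ^ k * k.factorial) := by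
    rw [show ((2 * k + 3 : ℕ) : ℂ) - 1 = ((2 * k + 1 : ℕ) : ℂ) + 1 by push_cast; ring,
      Complex.Gamma_nat_eq_factorial, Nat.factorial_eq_mul_doubleFactorial,
      Nat.doubleFactorial_two_mul]
    push_cast
    rfl
  have hp := poch_natCast_add_one k n
  have hnk : ((n + k).factorial : ℂ) ≠ 0 := by exact_mod_cast (n + k).factorial_ne_zero
  have hp0 : poch ((k : ℂ) + 1) n ≠ 0 := fun h0 => hnk (by rw [← hp, h0, zero_mul])
  have hdesc : (n.factorial : ℂ) * (k + n).descFactorial k = (n + k).factorial := by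
    have := Nat.factorial_mul_descFactorial (Nat.le_add_right k n)
    rw [Nat.add_sub_cancel_left, add_comm k n] at this
    rw [add_comm k n]
    exact_mod_cast this
  have hdesc' : ((k + n).descFactorial k : ℂ) = (n + k).factorial / n.factorial := by
    rw [← hdesc]
    field_simp
  rw [hG1, hG2, pochQ, pochQ, hA, hB, hdesc', Nat.add_sub_cancel_left, add_comm k n, ← hp,
    show μ + (2 * k + 3 : ℕ) - 2 = μ + 2 * k + 1 by push_cast; ring,
    show z - 1 = -1 * (1 - z) by ring, mul_pow, div_pow, div_pow, pow_add, pow_add]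
  field_simp
  ring_nf
  simp only [pow_mul', neg_one_sq, one_pow, mul_one]

lemma legP_eq (k : ℕ) {μ : ℂ} (hμ : ∀ m : ℕ, μ + 1 + m ≠ 0) {z : ℂ} (hz : ‖(1 - z) / 2‖ < 1) :
    legP z μ (2 * k + 3) = 1 / ((2 * k + 1).doubleFactorial : ℂ) *
      iteratedDeriv k (fun w => legL (μ + k) ((1 - w) / 2)) z := by
  obtain ⟨r, hr, hr1⟩ := exists_between hz
  obtain ⟨s, hs0, hs1, hq⟩ := exists_between_sq hr1
  obtain ⟨K, ha, hb⟩ := exists_nat_bound (-(μ + k)) (μ + k + 1)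
  have hr0 : 0 ≤ r := (norm_nonneg _).trans hr.le
  have hT := tendsto_sum_iteratedDeriv
    (f := fun n w => pochQ (-(μ + k)) n * pochQ (μ + k + 1) n * ((1 - w) / 2) ^ n)
    (U := (fun w : ℂ => (1 - w) / 2) ⁻¹' Metric.ball 0 r)
    (Metric.isOpen_ball.preimage (by fun_prop))
    ((summable_geometric_of_lt_one (by positivity) hq).mul_left ((1 - s)⁻¹ ^ (2 * (K + 1))))
    (fun n => by fun_prop) (fun n w hw => ?_) (z := z) (mem_ball_zero_iff.2 hr) k
  · have hF := (summable_F21_natCast_add_one (-μ) (μ + (2 * k + 3 : ℕ) - 2) k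
      hz).hasSum.tendsto_sum_nat.const_mul (Complex.Gamma (μ + (2 * k + 3 : ℕ) - 2) /
        (Complex.Gamma (μ + 1) * Complex.Gamma (((2 * k + 3 : ℕ) : ℂ) - 1)))
    have hT' := ((tendsto_add_atTop_iff_nat k).2 hT).const_mul
      (1 / ((2 * k + 1).doubleFactorial : ℂ))
    rw [legP, F21, show (((2 * k + 3 : ℕ) : ℂ) - 1) / 2 = k + 1 by push_cast; ring]
    refine tendsto_nhds_unique (hF.congr fun N => ?_) hT'
    have h0 : ∑ n ∈ Finset.range k, iteratedDeriv k
        (fun w => pochQ (-(μ + k)) n * pochQ (μ + k + 1) n * ((1 - w) / 2) ^ n) z = 0 :=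
      Finset.sum_eq_zero fun n hn => by
        rw [iteratedDeriv_mul_half_pow, Nat.descFactorial_of_lt (Finset.mem_range.1 hn)]
        simp
    rw [add_comm N k, Finset.sum_range_add, h0, zero_add, Finset.mul_sum, Finset.mul_sum]
    refine Finset.sum_congr rfl fun n _ => ?_
    rw [iteratedDeriv_mul_half_pow]
    exact Gamma_div_mul_poch_eq k n hμ z
  · have := norm_term_le ha hb hs0 hs1 (x := (1 - w) / 2) (y := 0) (mem_ball_zero_iff.1 hw).le
      (by simpa using hr0) n 0
    simpa only [add_zero, pow_zero, mul_one] using this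

lemma differentiableOn_legL (ν : ℂ) : DifferentiableOn ℂ (legL ν) (Metric.ball 0 1) := by
  intro x hx
  obtain ⟨r, hr, hr1⟩ := exists_between (mem_ball_zero_iff.1 hx)
  obtain ⟨s, hs0, hs1, hq⟩ := exists_between_sq hr1
  obtain ⟨K, ha, hb⟩ := exists_nat_bound (-ν) (ν + 1)
  have hr0 : 0 ≤ r := (norm_nonneg _).trans hr.le
  have hd : DifferentiableOn ℂ (legL ν) (Metric.ball 0 r) := by
    refine Complex.differentiableOn_tsum_of_summable_norm
      ((summable_geometric_of_lt_one (by positivity) hq).mul_left ((1 - s)⁻¹ ^ (2 * (K + 1))))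
      (fun n => by fun_prop) Metric.isOpen_ball (fun n w hw => ?_)
    have := norm_term_le ha hb hs0 hs1 (x := w) (y := 0) (mem_ball_zero_iff.1 hw).le
      (by simpa using hr0) n 0
    simpa only [add_zero, pow_zero, mul_one] using this
  exact (hd.differentiableAt
    (Metric.isOpen_ball.mem_nhds (mem_ball_zero_iff.2 hr))).differentiableWithinAt

/-- The generating series of the Legendre functions `P_{δ+l}(w)`. -/
noncomputable def legGen (δ h w : ℂ) : ℂ := ∑' l : ℕ, h ^ l * legL (δ + l) ((1 - w) / 2)

lemma legGen_iteratedDeriv (δ : ℂ) {z h : ℝ} (hz : z ∈ Set.Ioo (-1 : ℝ) 1)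
    (hh : h ∈ Set.Ioo (0 : ℝ) 1) (j : ℕ) :
    Tendsto (fun N => ∑ l ∈ Finset.range N,
        (h : ℂ) ^ l * iteratedDeriv j (fun w => legL (δ + l) ((1 - w) / 2)) (z : ℂ)) atTop
      (nhds (iteratedDeriv j (fun t : ℝ => legGen δ h t) z)) := by
  obtain ⟨ρ, hρ1, hρh⟩ := exists_between (one_lt_inv_iff₀.2 hh)
  have hρ0 : 0 < ρ := by linarith
  have hq : h * ρ < 1 := by
    calc h * ρ < h * h⁻¹ := mul_lt_mul_of_pos_left hρh hh.1
      _ = 1 := mul_inv_cancel₀ hh.1.ne'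
  obtain ⟨ε, hε, C, hC⟩ := exists_legL_bound δ (c := (1 - z) / 2) (by linarith [hz.2])
    (by linarith [hz.1]) hρ1
  set U := (fun w : ℂ => (1 - w) / 2) ⁻¹' Metric.ball (((1 - z) / 2 : ℝ) : ℂ) ε with hU
  have hUo : IsOpen U := Metric.isOpen_ball.preimage (by fun_prop)
  have hzU : (z : ℂ) ∈ U := by
    rw [hU, Set.mem_preimage, show (1 - (z : ℂ)) / 2 = ((1 - z) / 2 : ℝ) by push_cast; rfl]
    exact Metric.mem_ball_self hε
  have hd : ∀ l : ℕ, DifferentiableOn ℂ (fun w => (h : ℂ) ^ l * legL (δ + l) ((1 - w) / 2)) U :=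
    fun l => ((differentiableOn_legL (δ + l)).comp (f := fun w : ℂ => (1 - w) / 2) (by fun_prop)
      fun w hw => mem_ball_zero_iff.2 (hC ((1 - w) / 2) hw).1).const_mul _
  have hb : ∀ l : ℕ, ∀ w ∈ U, ‖(h : ℂ) ^ l * legL (δ + l) ((1 - w) / 2)‖ ≤ C * (h * ρ) ^ l :=
    fun l w hw => by
      rw [norm_mul, norm_pow, Complex.norm_real, Real.norm_of_nonneg hh.1.le, mul_pow,
        mul_left_comm]
      exact mul_le_mul_of_nonneg_left ((hC _ hw).2 l) (pow_nonneg hh.1.le l)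
  have hs : Summable fun l : ℕ => C * (h * ρ) ^ l :=
    (summable_geometric_of_lt_one (mul_nonneg hh.1.le hρ0.le) hq).mul_left C
  have hT := tendsto_sum_iteratedDeriv hUo hs hd hb hzU j
  have hg : DifferentiableOn ℂ (fun w => legGen δ h w) U :=
    Complex.differentiableOn_tsum_of_summable_norm hs hd hUo hb
  rw [iteratedDeriv_ofReal hUo hg j z hzU]
  exact hT.congr fun N => Finset.sum_congr rfl fun l _ => iteratedDeriv_const_mul_field _ _

lemma appell_eq_legGen (δ : ℂ) {t h : ℝ} (ht : t ∈ Set.Ioo (-1 : ℝ) 1)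
    (hh : h ∈ Set.Ioo (0 : ℝ) 1) :
    (1 / (Real.sqrt (1 + h ^ 2 - 2 * h * t) : ℂ)) *
      (F1A (-δ) δ 1 1 ((1 - (t : ℂ)) / 2)
          ((1 - ((1 - Real.sqrt (1 + h ^ 2 - 2 * h * t)) / h : ℝ)) / 2) +
        δ * ((((1 - Real.sqrt (1 + h ^ 2 - 2 * h * t)) / h : ℝ) - (t : ℂ)) / 2) *
          F1A (1 - δ) (1 + δ) 1 2 ((1 - (t : ℂ)) / 2)
            ((1 - (1 - (((1 + Real.sqrt (1 + h ^ 2 - 2 * h * t)) / h : ℝ) : ℂ) * t) /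
                ((t : ℂ) - (((1 + Real.sqrt (1 + h ^ 2 - 2 * h * t)) / h : ℝ) : ℂ))) / 2)) =
      legGen δ h t := by
  obtain ⟨ht1, ht2⟩ := ht
  obtain ⟨hh1, hh2⟩ := hh
  have hpos : 0 < 1 + h ^ 2 - 2 * h * t := by nlinarith
  set R := Real.sqrt (1 + h ^ 2 - 2 * h * t) with hR
  have hR0 : 0 < R := Real.sqrt_pos.2 hpos
  have hRsq : R ^ 2 = 1 + h ^ 2 - 2 * h * t := Real.sq_sqrt hpos.le
  have hRlo : 1 - h < R := Real.lt_sqrt_of_sq_lt (by nlinarith)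
  have hRhi : R < 1 + h := (Real.sqrt_lt' (by linarith)).2 (by nlinarith)
  have hden : t - (1 + R) / h < 0 := by
    rw [sub_neg, lt_div_iff₀ hh1]
    nlinarith
  have hτ : (1 - (1 + R) / h * t) / (t - (1 + R) / h) = (1 - R) / h := by
    rw [div_eq_iff hden.ne]
    field_simp
    linear_combination -hRsq
  have hτ' : (1 - (((1 + R) / h : ℝ) : ℂ) * t) / ((t : ℂ) - (((1 + R) / h : ℝ) : ℂ)) =
      ((1 - R) / h : ℝ) := by
    rw [← hτ]
    push_cast
    rfl
  rw [hτ']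
  obtain ⟨c, hc⟩ : ∃ c : ℝ, c = (1 - t) / 2 := ⟨_, rfl⟩
  obtain ⟨y, hy⟩ : ∃ y : ℝ, y = (1 - (1 - R) / h) / 2 := ⟨_, rfl⟩
  have hc' : (1 - (t : ℂ)) / 2 = c := by rw [hc]; push_cast; rfl
  have hy' : (1 - (((1 - R) / h : ℝ) : ℂ)) / 2 = y := by rw [hy]; push_cast; rfl
  have hyR : R = 1 - h * (1 - 2 * y) := by
    rw [hy]
    field_simp
    ring
  have hyh : h * (y * (1 - y)) = y - c := by
    have ht : t = 1 - 2 * c := by rw [hc]; ring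
    rw [ht, hyR] at hRsq
    have : 4 * h * (h * (y * (1 - y))) = 4 * h * (y - c) := by linear_combination -hRsq
    exact mul_left_cancel₀ (by positivity) this
  have hy0 : 0 < y := by nlinarith
  have hy1 : y < 1 := by nlinarith
  have hp : 0 < y * (1 - y) := mul_pos hy0 (by linarith)
  have hcy : c ≤ y := by nlinarith
  have hyc : y ^ 2 < c := by nlinarith
  have hc0 : 0 < c := by linarith
  have hc1 : c < 1 := by linarith
  have hquot : ((y : ℂ) - c) / (y * (1 - y)) = h := by
    rw [div_eq_iff (by exact_mod_cast hp.ne')]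
    exact_mod_cast hyh.symm
  have hpre : ((((1 - R) / h : ℝ) : ℂ) - t) / 2 = c - y := by
    rw [← hc', ← hy']
    ring
  have hRc : (R : ℂ) = 1 - h * (1 - 2 * y) := by exact_mod_cast hyR
  have hRne : (R : ℂ) ≠ 0 := by exact_mod_cast hR0.ne'
  have hgen := generating δ hc0 hc1 hcy hyc
  rw [hquot, ← hRc] at hgen
  rw [hpre, hc', hy', F1A_add_eq δ (by rwa [Complex.norm_real, Real.norm_of_nonneg hc0.le])
    (by rwa [Complex.norm_real, Real.norm_of_nonneg hy0.le]), hgen, ← mul_assoc,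
    one_div_mul_cancel hRne, one_mul, legGen, hc']

/-- Shifted generating-function formula in odd dimensions `D ≥ 5`: with `k = (D-3)/2`,
`δ_D = δ + k`, `z ∈ (-1,1)`, `0 < h < 1`,
`Σ_l h^l P(z,l+δ,D) = (1/(D-2)!!) (d/dz)^k S(z)` where
`S(z) = (1+h²-2hz)^{-1/2}[F1(-δ_D,δ_D,1;1;(1-z)/2,(1-t₋)/2)
  + δ_D((t₋-z)/2)F1(1-δ_D,1+δ_D,1;2;(1-z)/2,(1-τ(t₊))/2)]`,
`t± = (1±√(1+h²-2hz))/h`, `τ(t) = (1-tz)/(z-t)` (all depending on `z`). -/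
theorem stmt4 (D : ℕ) (hD : 5 ≤ D) (hDodd : Odd D) (k : ℕ) (hk : k = (D - 3) / 2)
    (δ : ℂ) (hδ : ∀ m : ℤ, δ ≠ m) (z h : ℝ)
    (hz : z ∈ Set.Ioo (-1 : ℝ) 1) (hh : h ∈ Set.Ioo (0 : ℝ) 1) :
    Tendsto (fun N : ℕ => ∑ l ∈ Finset.range N, (h : ℂ) ^ l * legP (z : ℂ) ((l : ℂ) + δ) D)
      atTop
      (nhds ((1 / ((D - 2).doubleFactorial : ℂ)) *
        iteratedDeriv k (fun t : ℝ =>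
          (1 / (Real.sqrt (1 + h ^ 2 - 2 * h * t) : ℂ)) *
            (F1A (-(δ + k)) (δ + k) 1 1 ((1 - (t : ℂ)) / 2)
                ((1 - ((1 - Real.sqrt (1 + h ^ 2 - 2 * h * t)) / h : ℝ)) / 2) +
              (δ + k) * ((((1 - Real.sqrt (1 + h ^ 2 - 2 * h * t)) / h : ℝ) - (t : ℂ)) / 2) *
                F1A (1 - (δ + k)) (1 + (δ + k)) 1 2 ((1 - (t : ℂ)) / 2)
                  ((1 - (1 - (((1 + Real.sqrt (1 + h ^ 2 - 2 * h * t)) / h : ℝ) : ℂ) * t) /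
                      ((t : ℂ) - (((1 + Real.sqrt (1 + h ^ 2 - 2 * h * t)) / h : ℝ) : ℂ))) / 2)))
          z)) := by
  obtain rfl : D = 2 * k + 3 := by
    obtain ⟨m, rfl⟩ := hDodd
    omega
  have hμ : ∀ l : ℕ, ∀ m : ℕ, (l : ℂ) + δ + 1 + m ≠ 0 := fun l m h0 =>
    hδ (-(l + 1 + m)) (by push_cast; linear_combination h0)
  have hzn : ‖(1 - (z : ℂ)) / 2‖ < 1 := by
    rw [show (1 - (z : ℂ)) / 2 = ((1 - z) / 2 : ℝ) by push_cast; rfl, Complex.norm_real,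
      Real.norm_of_nonneg (by linarith [hz.2])]
    linarith [hz.1]
  have hev : ∀ᶠ t in nhds z, t ∈ Set.Ioo (-1 : ℝ) 1 := isOpen_Ioo.mem_nhds hz
  rw [Filter.EventuallyEq.iteratedDeriv_eq k
    (hev.mono fun t ht => appell_eq_legGen (δ + k) ht hh)]
  refine ((legGen_iteratedDeriv (δ + k) hz hh k).const_mul _).congr fun N => ?_
  rw [Finset.mul_sum]
  refine Finset.sum_congr rfl fun l _ => ?_
  rw [legP_eq k (hμ l) hzn, show 2 * k + 3 - 2 = 2 * k + 1 by omega,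
    show δ + (k : ℂ) + l = l + δ + k by ring]
  ring
end

section
/- For every ν ∈ ℂ \ ℤ and every real α with 0 ≤ α ≤ 2π, the absolutely convergent series identity 1/(2ν²) + Σ_{l=1}^∞ cos(lα)/(ν² − l²) = (π/sin(πν)) · cos(να − νπ)/(2ν) holds. -/
open Filter

theorem sq_sub_intCast_sq_ne_zero {ν : ℂ} (hν : ∀ m : ℤ, ν ≠ m) (n : ℤ) :
    ν ^ 2 - (n : ℂ) ^ 2 ≠ 0 := by
  rw [sq_sub_sq]
  refine mul_ne_zero (fun h => hν (-n) ?_) (sub_ne_zero.mpr (hν n))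
  push_cast
  exact eq_neg_of_add_eq_zero_left h

theorem summable_one_div_sq_sub_add_one_sq {ν : ℂ} (hν : ∀ m : ℤ, ν ≠ m) :
    Summable fun l : ℕ => 1 / (ν ^ 2 - ((l : ℂ) + 1) ^ 2) := by
  have hmem : ν ∈ Complex.integerComplement := by
    rintro ⟨m, hm⟩
    exact hν m hm.symm
  have hν₀ : ν ≠ 0 := by simpa using hν 0
  refine ((summable_cotTerm hmem).mul_left (1 / (2 * ν))).congr fun l => ?_
  rw [cotTerm_identity hmem l, sq_sub_sq]
  field_simp

theorem summable_one_div_sq_sub_intCast_sq {ν : ℂ} (hν : ∀ m : ℤ, ν ≠ m) :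
    Summable fun n : ℤ => 1 / (ν ^ 2 - (n : ℂ) ^ 2) := by
  have h : Summable fun n : ℕ => 1 / (ν ^ 2 - (n : ℂ) ^ 2) := by
    rw [← summable_nat_add_iff 1]
    simpa using summable_one_div_sq_sub_add_one_sq hν
  exact Summable.of_nat_of_neg (by simpa using h) (by simpa using h)

theorem hasDerivAt_exp_mul_sin_add_cos {ν : ℂ} (hν : ∀ m : ℤ, ν ≠ m) (n : ℤ) (x : ℝ) :
    HasDerivAt (fun x : ℝ => Complex.exp (-(Complex.I * n * x)) *
        ((ν * Complex.sin (ν * x - ν * Real.pi) -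
          Complex.I * n * Complex.cos (ν * x - ν * Real.pi)) / (ν ^ 2 - (n : ℂ) ^ 2)))
      (Complex.exp (-(Complex.I * n * x)) * Complex.cos (ν * x - ν * Real.pi)) x := by
  have hx : HasDerivAt (fun x : ℝ => (x : ℂ)) 1 x := Complex.ofRealCLM.hasDerivAt
  have harg := (hx.const_mul ν).sub_const (ν * Real.pi)
  have hexp := (hx.const_mul (Complex.I * n)).neg.cexp
  have hne := sq_sub_intCast_sq_ne_zero hν n
  have hsin := (Complex.hasDerivAt_sin _).comp x harg
  have hcos := (Complex.hasDerivAt_cos _).comp x harg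
  have htrig := ((hsin.const_mul ν).sub (hcos.const_mul (Complex.I * n))).div_const
    (ν ^ 2 - (n : ℂ) ^ 2)
  convert! hexp.mul htrig using 1
  simp only [Pi.neg_apply, Pi.sub_apply, Function.comp_apply]
  field_simp
  linear_combination (-Complex.cos (ν * (x - Real.pi)) * n ^ 2) * Complex.I_sq

theorem fourierCoeffOn_cos {ν : ℂ} (hν : ∀ m : ℤ, ν ≠ m) (n : ℤ) :
    fourierCoeffOn Real.two_pi_pos (fun x : ℝ => Complex.cos (ν * x - ν * Real.pi)) n =
      ν * Complex.sin (Real.pi * ν) / Real.pi * (1 / (ν ^ 2 - (n : ℂ) ^ 2)) := by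
  have hne := sq_sub_intCast_sq_ne_zero hν n
  have hπ : (Real.pi : ℂ) ≠ 0 := Complex.ofReal_ne_zero.mpr Real.pi_ne_zero
  have hchar (x : ℝ) : fourier (-n) (x : AddCircle (2 * Real.pi - 0)) =
      Complex.exp (-(Complex.I * n * x)) := by
    rw [fourier_coe_apply]
    congr 1
    push_cast
    field_simp
    ring
  have hperiod : Complex.exp (-(Complex.I * n * (2 * Real.pi : ℝ))) = 1 := by
    rw [Complex.exp_eq_one_iff]
    exact ⟨-n, by push_cast; ring⟩
  rw [fourierCoeffOn_eq_integral]
  simp_rw [hchar, smul_eq_mul]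
  rw [intervalIntegral.integral_eq_sub_of_hasDerivAt
    (fun x _ => hasDerivAt_exp_mul_sin_add_cos hν n x)
    (Continuous.intervalIntegrable (by fun_prop) _ _), hperiod]
  have h₁ : ν * ((2 * Real.pi : ℝ) : ℂ) - ν * Real.pi = Real.pi * ν := by push_cast; ring
  have h₂ : ν * ((0 : ℝ) : ℂ) - ν * Real.pi = -(Real.pi * ν) := by push_cast; ring
  rw [h₁, h₂, Complex.sin_neg, Complex.cos_neg, Complex.real_smul]
  simp only [Complex.ofReal_zero, mul_zero, neg_zero, Complex.exp_zero]
  push_cast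
  field_simp
  ring

theorem hasSum_fourier_cos {ν : ℂ} (hν : ∀ m : ℤ, ν ≠ m) {α : ℝ}
    (hα : α ∈ Set.Icc 0 (2 * Real.pi)) :
    HasSum (fun n : ℤ => ν * Complex.sin (Real.pi * ν) / Real.pi * (1 / (ν ^ 2 - (n : ℂ) ^ 2)) *
      Complex.exp (Complex.I * n * α)) (Complex.cos (ν * α - ν * Real.pi)) := by
  have : Fact (0 < 2 * Real.pi) := ⟨Real.two_pi_pos⟩
  set f : ℝ → ℂ := fun x => Complex.cos (ν * x - ν * Real.pi) with hf
  have hends : f 0 = f (2 * Real.pi) := by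
    simp only [hf]
    rw [← Complex.cos_neg]
    congr 1
    push_cast
    ring
  let F : C(AddCircle (2 * Real.pi), ℂ) := ⟨AddCircle.liftIco (2 * Real.pi) 0 f,
    AddCircle.liftIco_zero_continuous hends (by fun_prop)⟩
  have hcoeff (n : ℤ) : fourierCoeff F n =
      ν * Complex.sin (Real.pi * ν) / Real.pi * (1 / (ν ^ 2 - (n : ℂ) ^ 2)) := by
    rw [ContinuousMap.coe_mk, fourierCoeff_liftIco_eq]
    simpa only [zero_add] using! fourierCoeffOn_cos hν n
  have hF : F (α : AddCircle (2 * Real.pi)) = f α := by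
    rcases hα.2.lt_or_eq with h | rfl
    · exact AddCircle.liftIco_coe_apply (f := f) ⟨hα.1, by simpa using h⟩
    · rw [AddCircle.coe_period, ← hends]
      exact AddCircle.liftIco_coe_apply (f := f) (x := 0) (by simp [Real.pi_pos])
  have hsum := has_pointwise_sum_fourier_series_of_summable
    (((summable_one_div_sq_sub_intCast_sq hν).mul_left _).congr fun n => (hcoeff n).symm)
    (α : AddCircle (2 * Real.pi))
  rw [hF] at hsum
  refine hsum.congr_fun fun n => ?_
  rw [hcoeff, smul_eq_mul, fourier_coe_apply]
  congr 2
  have hπ : (Real.pi : ℂ) ≠ 0 := Complex.ofReal_ne_zero.mpr Real.pi_ne_zero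
  push_cast
  field_simp

/-- Degenerate (two-dimensional) case of Dougall's identity: for `ν ∈ ℂ \ ℤ` and
`α ∈ [0,2π]`, `1/(2ν²) + Σ_{l≥1} cos(lα)/(ν²-l²) = (π/sin(πν))·cos(να-νπ)/(2ν)`,
the series being absolutely convergent. -/
theorem stmt7 (ν : ℂ) (hν : ∀ m : ℤ, ν ≠ m) (α : ℝ) (hα₀ : 0 ≤ α) (hα₁ : α ≤ 2 * Real.pi) :
    Summable (fun l : ℕ => ‖Complex.cos (((l : ℂ) + 1) * α) / (ν ^ 2 - ((l : ℂ) + 1) ^ 2)‖) ∧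
    1 / (2 * ν ^ 2) + ∑' l : ℕ, Complex.cos (((l : ℂ) + 1) * α) / (ν ^ 2 - ((l : ℂ) + 1) ^ 2) =
      (Real.pi : ℂ) / Complex.sin (Real.pi * ν) *
        (Complex.cos (ν * α - ν * Real.pi) / (2 * ν)) := by
  have hν₀ : ν ≠ 0 := by simpa using hν 0
  have hπ : (Real.pi : ℂ) ≠ 0 := Complex.ofReal_ne_zero.mpr Real.pi_ne_zero
  have hsin : Complex.sin (Real.pi * ν) ≠ 0 := by
    apply sin_pi_mul_ne_zero
    rintro ⟨m, hm⟩
    exact hν m hm.symm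
  have hsummable : Summable fun l : ℕ =>
      ‖Complex.cos (((l : ℂ) + 1) * α) / (ν ^ 2 - ((l : ℂ) + 1) ^ 2)‖ := by
    refine (summable_one_div_sq_sub_add_one_sq hν).norm.of_nonneg_of_le
      (fun _ => norm_nonneg _) fun l => ?_
    rw [norm_div, norm_div, norm_one]
    gcongr
    have h : Complex.cos (((l : ℂ) + 1) * α) = (Real.cos ((l + 1) * α) : ℂ) := by push_cast; rfl
    rw [h, Complex.norm_real]
    exact Real.abs_cos_le_one _
  refine ⟨hsummable, ?_⟩
  have hnat := (hasSum_nat_add_iff' 1).mpr (hasSum_fourier_cos hν ⟨hα₀, hα₁⟩).nat_add_neg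
  have hcos : HasSum
      (fun l : ℕ => Complex.cos (((l : ℂ) + 1) * α) / (ν ^ 2 - ((l : ℂ) + 1) ^ 2))
      (Real.pi / (2 * ν * Complex.sin (Real.pi * ν)) * (Complex.cos (ν * α - ν * Real.pi) -
        ν * Complex.sin (Real.pi * ν) / Real.pi * (1 / ν ^ 2))) := by
    convert! hnat.mul_left (Real.pi / (2 * ν * Complex.sin (Real.pi * ν))) using 1
    · ext l
      have hne : ν ^ 2 - ((l : ℂ) + 1) ^ 2 ≠ 0 := by
        simpa using sq_sub_intCast_sq_ne_zero hν (l + 1)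
      have h₁ : Complex.I * ((l : ℂ) + 1) * α = (((l : ℂ) + 1) * α) * Complex.I := by ring
      have h₂ : Complex.I * -((l : ℂ) + 1) * α = -(((l : ℂ) + 1) * α) * Complex.I := by ring
      push_cast
      rw [neg_sq, h₁, h₂, Complex.cos]
      generalize Complex.sin (Real.pi * ν) = s at hsin ⊢
      field_simp
    · simp
  rw [hcos.tsum_eq]
  generalize Complex.sin (Real.pi * ν) = s at hsin ⊢
  field_simp
  ring
end
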